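/- For every integer k ≥ 3 there exists n₀ ∈ ℕ such that for all n ≥ n₀: F_{2k+1}(n) = 2n²/9 + 1 if n ≡ 0 (mod 6); F_{2k+1}(n) = 2n²/9 + (n+13)/18 if n ≡ 1 (mod 6); F_{2k+1}(n) = 2n²/9 − (n−22)/18 if n ≡ 2 (mod 6); F_{2k+1}(n) = 2n²/9 + 1 if n ≡ 3 (mod 6); F_{2k+1}(n) = 2n²/9 + (n+22)/18 if n ≡ 4 (mod 6); and F_{2k+1}(n) = 2n²/9 − (n−13)/18 if n ≡ 5 (mod 6). -/

import Mathlib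

open SimpleGraph

/-- An edge `e` of `G` occurs in `C_m`: `G` contains a cycle of length `m`
whose edge set contains `e`. -/
def occursInC {V : Type*} (G : SimpleGraph V) (m : ℕ) (e : Sym2 V) : Prop :=
  ∃ (u : V) (w : G.Walk u u), w.IsCycle ∧ w.length = m ∧ e ∈ w.edges

/-- The number of edges of `G` that occur in a cycle of length `m`. -/
noncomputable def countEdgesInC {V : Type*} (G : SimpleGraph V) (m : ℕ) : ℕ :=
  {e | e ∈ G.edgeSet ∧ occursInC G m e}.ncard

/-- `F_{2k+1}(n)`: the minimum over all graphs on `n` vertices with exactly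
`⌊n²/4⌋ + 1` edges of the number of edges occurring in `C_{2k+1}`. -/
noncomputable def Fodd (k n : ℕ) : ℕ :=
  sInf {m : ℕ | ∃ G : SimpleGraph (Fin n),
    G.edgeSet.ncard = n ^ 2 / 4 + 1 ∧ countEdgesInC G (2 * k + 1) = m}

open scoped Classical

/-- path of length `j` from `x` to `y` avoiding `F`. -/
def Pth {V : Type*} [DecidableEq V] (G : SimpleGraph V) : ℕ → V → V → Finset V → Prop
  | 0, x, y, F => x = y ∧ x ∉ F
  | j + 1, x, y, F => x ∉ F ∧ ∃ z, G.Adj x z ∧ Pth G j z y (insert x F)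

theorem Pth_walk {V : Type*} [DecidableEq V] {G : SimpleGraph V} {j : ℕ} : ∀ {x y : V}
    {F : Finset V}, Pth G j x y F →
    ∃ p : G.Walk x y, p.IsPath ∧ p.length = j ∧ ∀ v ∈ p.support, v ∉ F := by
  induction j with
  | zero =>
    intro x y F h
    obtain ⟨rfl, h⟩ := h
    exact ⟨Walk.nil, by simp, by simp, by simpa using h⟩
  | succ j ih =>
    intro x y F h
    obtain ⟨h1, z, h2, h3⟩ := h
    obtain ⟨p, hp, hl, hs⟩ := ih h3
    refine ⟨Walk.cons h2 p, ?_, by simp [hl], ?_⟩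
    · rw [Walk.cons_isPath_iff]
      refine ⟨hp, fun hx => ?_⟩
      have := hs _ hx
      simp at this
    · intro v hv
      rw [Walk.support_cons, List.mem_cons] at hv
      rcases hv with rfl | hv
      · exact h1
      · have := hs _ hv
        simp at this
        exact this.2

theorem Pth_of_walk {V : Type*} [DecidableEq V] {G : SimpleGraph V} {x y : V} (p : G.Walk x y) :
    ∀ {F : Finset V}, p.IsPath → (∀ v ∈ p.support, v ∉ F) → Pth G p.length x y F := by
  induction p with
  | nil => intro F _ h; exact ⟨rfl, h _ (by simp)⟩
  | cons h p ih =>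
    intro F hp hs
    rw [Walk.cons_isPath_iff] at hp
    refine ⟨hs _ (by simp), _, h, ih hp.1 ?_⟩
    intro v hv
    simp only [Finset.mem_insert, not_or]
    refine ⟨?_, hs _ (by simp [hv])⟩
    rintro rfl
    exact hp.2 hv

theorem Pth_symm {V : Type*} [DecidableEq V] {G : SimpleGraph V} {j : ℕ} {x y : V}
    {F : Finset V} (h : Pth G j x y F) : Pth G j y x F := by
  obtain ⟨p, hp, hl, hs⟩ := Pth_walk h
  have := Pth_of_walk p.reverse (F := F) hp.reverse (by simpa using hs)
  rwa [Walk.length_reverse, hl] at this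

theorem Pth_cons {V : Type*} [DecidableEq V] {G : SimpleGraph V} {j : ℕ} {x z y : V}
    {F : Finset V} (hx : x ∉ F) (hz : G.Adj x z) (h : Pth G j z y (insert x F)) :
    Pth G (j+1) x y F := ⟨hx, z, hz, h⟩

theorem Pth_snoc {V : Type*} [DecidableEq V] {G : SimpleGraph V} {j : ℕ} {x z y : V}
    {F : Finset V} (hx : z ∉ F) (hz : G.Adj y z) (h : Pth G j x y (insert z F)) :
    Pth G (j+1) x z F :=
  Pth_symm (Pth_cons hx hz.symm (Pth_symm h))

theorem Pth_mono {V : Type*} [DecidableEq V] {G : SimpleGraph V} {j : ℕ} {x y : V}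
    {F F' : Finset V} (hF : F' ⊆ F) (h : Pth G j x y F) : Pth G j x y F' := by
  obtain ⟨p, hp, hl, hs⟩ := Pth_walk h
  have := Pth_of_walk p (F := F') hp (fun v hv hv' => hs v hv (hF hv'))
  rwa [hl] at this

theorem red_of_Pth {V : Type*} [DecidableEq V] {G : SimpleGraph V} {k : ℕ} (hk : 1 ≤ k) {u v : V}
    (huv : G.Adj u v) (h : Pth G (2*k) u v ∅) : occursInC G (2*k+1) s(u,v) := by
  obtain ⟨p, hp, hl, hs⟩ := Pth_walk h
  refine ⟨v, Walk.cons huv.symm p, ?_, by simp [hl], by simp [Sym2.eq_swap]⟩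
  rw [Walk.cons_isCycle_iff]
  refine ⟨hp, fun he => ?_⟩
  cases p with
  | nil => simp at hl; omega
  | cons h q =>
    rw [Walk.cons_isPath_iff] at hp
    rw [Walk.edges_cons, List.mem_cons] at he
    rcases he with he | he
    · simp only [Sym2.eq_iff] at he
      rcases he with ⟨rfl, rfl⟩ | ⟨rfl, -⟩
      · exact huv.ne rfl
      · cases q with
        | nil => simp at hl; omega
        | cons h' q' =>
          rw [Walk.cons_isPath_iff] at hp
          exact hp.1.2 (by simp)
    · exact hp.2 (Walk.snd_mem_support_of_mem_edges _ he)

section regularity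
open Finset

theorem card_interedges_sum {V : Type*} [DecidableEq V] (G : SimpleGraph V) (S T : Finset V) :
    #(G.interedges S T) = ∑ x ∈ S, #(T.filter (G.Adj x)) := by
  unfold SimpleGraph.interedges Rel.interedges
  rw [card_filter, sum_product]
  refine sum_congr rfl fun x _ => ?_
  rw [card_filter]

theorem unif_bad {V : Type*} [DecidableEq V] {G : SimpleGraph V} {e : ℝ} {X Y Y' : Finset V}
    (h : G.IsUniform e X Y) (hd : 4 * e ≤ (G.edgeDensity X Y : ℝ)) (hY : Y' ⊆ Y)
    (hc : (#Y : ℝ) * e ≤ #Y') :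
    (#(X.filter fun x => (#(Y'.filter (G.Adj x)) : ℝ) < 3 * e * #Y') : ℝ) ≤ #X * e := by
  by_contra! hcon
  have he := h.pos
  set S := X.filter fun x => (#(Y'.filter (G.Adj x)) : ℝ) < 3 * e * #Y' with hS
  have h1 := h (filter_subset _ _ : S ⊆ X) hY hcon.le hc
  rw [abs_sub_lt_iff] at h1
  have h2 : (G.edgeDensity S Y' : ℝ) ≤ 3 * e := by
    rw [edgeDensity_def]
    push_cast
    refine div_le_of_le_mul₀ (by positivity) (by positivity) ?_
    rw [card_interedges_sum]
    push_cast
    calc ∑ x ∈ S, (#(Y'.filter (G.Adj x)) : ℝ) ≤ ∑ x ∈ S, 3 * e * #Y' := by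
          refine sum_le_sum fun x hx => ?_
          exact (mem_filter.1 hx).2.le
      _ = _ := by rw [sum_const, nsmul_eq_mul]; ring
  linarith [h1.2]

/-- regular, dense and large pair -/
def RPair {V : Type*} (G : SimpleGraph V) (e : ℝ) (M : ℕ) (X Y : Finset V) : Prop :=
  G.IsUniform e X Y ∧ 4 * e ≤ (G.edgeDensity X Y : ℝ) ∧ (M + 2 : ℝ) ≤ e ^ 2 * #X ∧
    (M + 2 : ℝ) ≤ e ^ 2 * #Y

theorem RPair.symm {V : Type*} [DecidableEq V] {G : SimpleGraph V} {e : ℝ} {M : ℕ} {X Y : Finset V}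
    (h : RPair G e M X Y) : RPair G e M Y X :=
  ⟨h.1.symm, by rw [edgeDensity_comm]; exact h.2.1, h.2.2.2, h.2.2.1⟩

inductive Chn {α : Type*} (R : α → α → Prop) : ℕ → α → α → Prop
  | one {X Y : α} : R X Y → Chn R 1 X Y
  | cons {i : ℕ} {X Y Z : α} : R X Y → Chn R i Y Z → Chn R (i+1) X Z

theorem chain_path {V : Type*} [DecidableEq V] {G : SimpleGraph V} {e : ℝ} {M : ℕ}
    (he1 : e ≤ 1) {i : ℕ} {X Y : Finset V} (h : Chn (RPair G e M) i X Y) (v : V)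
    (hv : (#Y : ℝ) * e ≤ #(Y.filter (G.Adj v))) :
    ∃ B : Finset V, (#B : ℝ) ≤ #X * e ∧ ∀ x ∈ X, x ∉ B → ∀ F : Finset V, x ∉ F → v ∉ F → x ≠ v →
      #F + i ≤ M → Pth G (i+1) x v F := by
  induction h with
  | @one X Y hR =>
    obtain ⟨hu, hd, hX, hY⟩ := hR
    have he := hu.pos
    refine ⟨_, unif_bad hu hd (filter_subset (G.Adj v) Y) hv, ?_⟩
    intro x hx hB F hxF hvF hxv hM
    simp only [mem_filter, hx, true_and, not_lt] at hB
    have hlt : #F < #((Y.filter (G.Adj v)).filter (G.Adj x)) := by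
      have : (#F : ℝ) < #((Y.filter (G.Adj v)).filter (G.Adj x)) := by
        have h1 : (#F : ℝ) ≤ M := by exact_mod_cast (by omega : #F ≤ M)
        have h2 : e * ((#Y : ℝ) * e) ≤ e * #(Y.filter (G.Adj v)) := by gcongr
        nlinarith
      exact_mod_cast this
    obtain ⟨z, hz, hzF⟩ := exists_mem_notMem_of_card_lt_card hlt
    simp only [mem_filter] at hz
    refine ⟨hxF, z, hz.2, ?_, v, hz.1.2.symm, rfl, ?_⟩
    · simp only [mem_insert, not_or]
      exact ⟨hz.2.ne', hzF⟩
    · simp only [mem_insert, not_or]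
      exact ⟨hz.1.2.ne, hxv.symm, hvF⟩
  | @cons i X Y Z hR _ ih =>
    obtain ⟨hu, hd, hX, hY⟩ := hR
    have he := hu.pos
    obtain ⟨B, hB, hBP⟩ := ih hv
    refine ⟨_, unif_bad hu hd (Subset.refl Y) (by nlinarith [(Nat.cast_nonneg (#Y) : (0:ℝ) ≤ (#Y : ℝ))]), ?_⟩
    intro x hx hB' F hxF hvF hxv hM
    simp only [mem_filter, hx, true_and, not_lt] at hB'
    have hlt : #(B ∪ insert v F) < #(Y.filter (G.Adj x)) := by
      have : (#(B ∪ insert v F) : ℝ) < #(Y.filter (G.Adj x)) := by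
        have h1 : #(B ∪ insert v F) ≤ #B + (#F + 1) :=
          (card_union_le _ _).trans (by gcongr; exact card_insert_le _ _)
        have h2 : (#(B ∪ insert v F) : ℝ) ≤ #B + (#F + 1) := by exact_mod_cast h1
        have h3 : (#F : ℝ) ≤ M := by exact_mod_cast (by omega : #F ≤ M)
        have h4 : e ^ 2 * #Y ≤ e * #Y := by
          have : e ^ 2 ≤ e := by nlinarith
          gcongr
        nlinarith
      exact_mod_cast this
    obtain ⟨z, hz, hzF⟩ := exists_mem_notMem_of_card_lt_card hlt
    simp only [mem_filter] at hz
    simp only [mem_union, mem_insert, not_or] at hzF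
    refine ⟨hxF, z, hz.2, hBP z hz.1 hzF.1 _ ?_ ?_ hzF.2.1 ?_⟩
    · simp only [mem_insert, not_or]; exact ⟨hz.2.ne', hzF.2.2⟩
    · simp only [mem_insert, not_or]; exact ⟨hxv.symm, hvF⟩
    · have := card_insert_le x F
      omega

theorem blue_pair {V : Type*} [DecidableEq V] {G : SimpleGraph V} {e : ℝ} {k : ℕ} (hk : 1 ≤ k)
    (he1 : e ≤ 1) {U Y W : Finset V} (h : Chn (RPair G e (2*k)) (2*k-1) U Y)
    (h2 : RPair G e (2*k) Y W) :
    (#((U ×ˢ W).filter fun p => G.Adj p.1 p.2 ∧ ¬ occursInC G (2*k+1) s(p.1,p.2)) : ℝ)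
      ≤ 2 * e * (#U * #W) := by
  have he := h2.1.pos
  set bl : V → V → Prop := fun a b => G.Adj a b ∧ ¬ occursInC G (2*k+1) s(a,b)
  have hb := unif_bad h2.symm.1 h2.symm.2.1 (Subset.refl Y)
    (by nlinarith [(Nat.cast_nonneg (#Y) : (0:ℝ) ≤ (#Y : ℝ))])
  set B := W.filter fun x => (#(Y.filter (G.Adj x)) : ℝ) < 3 * e * #Y with hBdef
  have e1 : (#((U ×ˢ W).filter fun p => bl p.1 p.2) : ℝ)
      = ∑ b ∈ W, (#(U.filter fun a => bl a b) : ℝ) := by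
    rw [card_filter, sum_product_right]
    push_cast
    refine sum_congr rfl fun x _ => ?_
    rw [card_filter]; push_cast; rfl
  have e2 : ∀ b ∈ W, (#(U.filter fun a => bl a b) : ℝ) ≤ #U * e + if b ∈ B then (#U : ℝ) else 0 := by
    intro b hbW
    split_ifs with hbB
    · have : (#(U.filter fun a => bl a b) : ℝ) ≤ #U := by exact_mod_cast card_filter_le _ _
      have : (0:ℝ) ≤ #U * e := by positivity
      linarith
    · simp only [hBdef, mem_filter, hbW, true_and, not_lt] at hbB
      obtain ⟨Bd, hBd, hP⟩ := chain_path he1 h b (by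
        have : (0:ℝ) ≤ #Y * e := by positivity
        linarith)
      have : (#(U.filter fun a => bl a b) : ℝ) ≤ #Bd := by
        have : U.filter (fun a => bl a b) ⊆ Bd := by
          intro a ha
          simp only [mem_filter, bl] at ha
          by_contra hn
          refine ha.2.2 (red_of_Pth hk ha.2.1 ?_)
          have := hP a ha.1 hn ∅ (by simp) (by simp) ha.2.1.ne (by simp)
          rwa [Nat.sub_add_cancel (by omega)] at this
        exact_mod_cast card_le_card this
      linarith
  change (#((U ×ˢ W).filter fun p => bl p.1 p.2) : ℝ) ≤ _
  rw [e1]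
  refine (sum_le_sum e2).trans ?_
  rw [sum_add_distrib, sum_const, nsmul_eq_mul, ← sum_filter, sum_const, nsmul_eq_mul]
  have : W.filter (· ∈ B) ⊆ B := fun x hx => (mem_filter.1 hx).2
  have : (#(W.filter (· ∈ B)) : ℝ) ≤ #B := by exact_mod_cast card_le_card this
  have : (#(W.filter (· ∈ B)) : ℝ) * #U ≤ (#W * e) * #U := by
    gcongr; linarith
  linarith

end regularity

section regularityA
open Finset

theorem chn_pad {α : Type*} {R : α → α → Prop} (hR : ∀ x y, R x y → R y x) {i : ℕ} {U W Y : α}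
    (h : R U W) (hc : Chn R i U Y) (j : ℕ) : Chn R (i + 2 * j) U Y := by
  induction j with
  | zero => exact hc
  | succ j ih => exact Chn.cons h (Chn.cons (hR _ _ h) ih)

theorem chn_tri {α : Type*} {R : α → α → Prop} (hR : ∀ x y, R x y → R y x) {k : ℕ} (hk : 3 ≤ k)
    {U T X Y : α} (h1 : U = T ∨ R U T) (h2 : R T X) (h3 : R X Y) (h4 : R Y T) :
    Chn R (2 * k - 1) U U := by
  rcases h1 with rfl | h1
  · have := chn_pad hR h2 (Chn.cons h2 (Chn.cons h3 (Chn.one h4))) (k - 2)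
    convert this using 1; omega
  · have := chn_pad hR h1 (Chn.cons h1 (Chn.cons h2 (Chn.cons h3 (Chn.cons h4 (Chn.one (hR _ _ h1))))))
      (k - 3)
    convert this using 1; omega

theorem lemmaA_aux {V : Type*} [Fintype V] [DecidableEq V] [Nonempty V] (G : SimpleGraph V) (k : ℕ)
    (hk : 3 ≤ k) (e : ℝ)
    (he : 0 < e) (he1 : e ≤ 1) (P : Finpartition (univ : Finset V)) (hP : P.IsEquipartition)
    (hU : P.IsUniform G e) (hl : 4 / e ≤ #P.parts)
    (hbig : ∀ X ∈ P.parts, ((2 * k : ℕ) + 2 : ℝ) ≤ e ^ 2 * #X) :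
    ∃ H : SimpleGraph V, H ≤ G ∧
      (#((univ : Finset (V × V)).filter fun p => G.Adj p.1 p.2 ∧ ¬ H.Adj p.1 p.2) : ℝ)
        ≤ 25 * e * (Fintype.card V) ^ 2 ∧
      ∀ u v t x y, H.Adj u v → (u = t ∨ H.Adj u t) → H.Adj t x → H.Adj x y → H.Adj y t →
        occursInC G (2 * k + 1) s(u, v) := by
  set R := RPair G e (2 * k) with hRdef
  set red : V → V → Prop := fun a b => occursInC G (2 * k + 1) s(a, b) with hred
  set cond : Finset V → Finset V → Prop := fun U W => ∃ Y, Chn R (2 * k - 1) U Y ∧ R Y W with hcond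
  have hRs : ∀ x y, R x y → R y x := fun x y h => h.symm
  let H : SimpleGraph V :=
    { Adj := fun a b => G.Adj a b ∧ R (P.part a) (P.part b) ∧
        (red a b ∨ (¬ cond (P.part a) (P.part b) ∧ ¬ cond (P.part b) (P.part a)))
      symm := ⟨by
        rintro a b ⟨h1, h2, h3⟩
        refine ⟨h1.symm, h2.symm, ?_⟩
        rcases h3 with h3 | h3
        · left; simp only [hred]; rw [Sym2.eq_swap]; exact h3
        · right; exact h3.symm⟩
      loopless := ⟨fun a h => G.loopless.irrefl a h.1⟩ }
  refine ⟨H, fun a b h => h.1, ?_, ?_⟩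
  · set B : Finset (V × V) := (P.parts ×ˢ P.parts).biUnion fun q =>
      if cond q.1 q.2 then (q.1 ×ˢ q.2).filter fun p => G.Adj p.1 p.2 ∧ ¬ red p.1 p.2 else ∅ with hB
    have hBc : (#B : ℝ) ≤ 2 * e * (Fintype.card V) ^ 2 := by
      calc (#B : ℝ) ≤ ∑ q ∈ P.parts ×ˢ P.parts, 2 * e * ((#q.1 : ℝ) * #q.2) := by
            refine le_trans (Nat.cast_le.2 card_biUnion_le) ?_
            push_cast
            refine sum_le_sum fun q _ => ?_
            split_ifs with hc
            · obtain ⟨Y, hY1, hY2⟩ := hc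
              exact blue_pair (by omega) he1 hY1 hY2
            · simp; positivity
        _ = 2 * e * ((∑ q ∈ P.parts, (#q : ℝ)) * (∑ q ∈ P.parts, (#q : ℝ))) := by
            rw [← mul_sum, sum_mul_sum, sum_product]
        _ = _ := by
            have := P.sum_card_parts
            have h2 : ∑ q ∈ P.parts, (#q : ℝ) = Fintype.card V := by
              rw [← card_univ, ← this]; push_cast; rfl
            rw [h2]; ring
    set B' : Finset (V × V) := B.image Prod.swap with hB'
    have hB'c : (#B' : ℝ) ≤ 2 * e * (Fintype.card V) ^ 2 :=
      le_trans (by exact_mod_cast card_image_le) hBc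
    have h1 := hP.sum_nonUniforms_lt univ_nonempty he hU
    have h2 := hP.card_biUnion_offDiag_le he hl
    have h3 := hP.card_interedges_sparsePairs_le (G := G) (by positivity : 0 ≤ 4 * e)
    set S1 := (P.nonUniforms G e).biUnion fun (U, V) ↦ U ×ˢ V
    set S2 := P.parts.biUnion offDiag
    set S3 := (P.sparsePairs G (4 * e)).biUnion fun (U, V) ↦ G.interedges U V
    have hsub : (univ : Finset (V × V)).filter (fun p => G.Adj p.1 p.2 ∧ ¬ H.Adj p.1 p.2) ⊆
        S1 ∪ S2 ∪ S3 ∪ B ∪ B' := by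
      rintro ⟨a, b⟩ hab
      simp only [mem_filter, mem_univ, true_and] at hab
      obtain ⟨hG, hH⟩ := hab
      have ha := P.part_mem.2 (mem_univ a)
      have hb := P.part_mem.2 (mem_univ b)
      have ha' := P.mem_part (mem_univ a)
      have hb' := P.mem_part (mem_univ b)
      simp only [mem_union]
      by_cases hR : R (P.part a) (P.part b)
      · have : ¬ red a b ∧ (cond (P.part a) (P.part b) ∨ cond (P.part b) (P.part a)) := by
          by_contra hcon
          apply hH
          refine ⟨hG, hR, ?_⟩
          tauto
        obtain ⟨hr, hc | hc⟩ := this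
        · left; right
          rw [hB, mem_biUnion]
          refine ⟨(P.part a, P.part b), by simp [ha, hb], ?_⟩
          simp only [hc, if_true]
          simp only [mem_filter, mem_product]
          exact ⟨⟨ha', hb'⟩, hG, hr⟩
        · right
          rw [hB', mem_image]
          refine ⟨(b, a), ?_, rfl⟩
          rw [hB, mem_biUnion]
          refine ⟨(P.part b, P.part a), by simp [ha, hb], ?_⟩
          simp only [hc, if_true]
          simp only [mem_filter, mem_product]
          refine ⟨⟨hb', ha'⟩, hG.symm, ?_⟩
          simp only [hred]; rw [Sym2.eq_swap]; exact hr
      · left; left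
        by_cases hUV : P.part a = P.part b
        · left; right
          rw [mem_biUnion]
          refine ⟨_, ha, ?_⟩
          rw [mem_offDiag]
          exact ⟨ha', hUV ▸ hb', hG.ne⟩
        by_cases hun : G.IsUniform e (P.part a) (P.part b)
        · right
          rw [mem_biUnion]
          refine ⟨(P.part a, P.part b), ?_, ?_⟩
          · rw [Finpartition.mk_mem_sparsePairs]
            refine ⟨ha, hb, hUV, ?_⟩
            by_contra! hcon
            exact hR ⟨hun, hcon, hbig _ ha, hbig _ hb⟩
          · simp only [mem_interedges_iff]
            exact ⟨ha', hb', hG⟩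
        · left; left
          rw [mem_biUnion]
          refine ⟨(P.part a, P.part b), ?_, ?_⟩
          · rw [Finpartition.mk_mem_nonUniforms]
            exact ⟨ha, hb, hUV, hun⟩
          · simp only [mem_product]; exact ⟨ha', hb'⟩
    have hcard := card_le_card hsub
    have u1 := card_union_le (S1 ∪ S2 ∪ S3 ∪ B) B'
    have u2 := card_union_le (S1 ∪ S2 ∪ S3) B
    have u3 := card_union_le (S1 ∪ S2) S3
    have u4 := card_union_le S1 S2
    have hcard2 : #((univ : Finset (V × V)).filter fun p => G.Adj p.1 p.2 ∧ ¬ H.Adj p.1 p.2) ≤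
      #S1 + #S2 + #S3 + #B + #B' := by omega
    have hcard3 : (#((univ : Finset (V × V)).filter fun p => G.Adj p.1 p.2 ∧ ¬ H.Adj p.1 p.2) : ℝ) ≤
      #S1 + #S2 + #S3 + #B + #B' := by exact_mod_cast hcard2
    rw [card_univ] at h1 h2 h3
    have : (0:ℝ) ≤ e * (Fintype.card V : ℝ) ^ 2 := by positivity
    refine le_trans (le_trans (le_of_eq ?_) hcard3) (by nlinarith)
    congr!
  · intro u v t x y huv hut htx hxy hyt
    have hR1 : Chn R (2 * k - 1) (P.part u) (P.part u) := by
      refine chn_tri hRs hk (T := P.part t) ?_ htx.2.1 hxy.2.1 hyt.2.1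
      rcases hut with rfl | h
      · left; rfl
      · right; exact h.2.1
    rcases huv.2.2 with h | h
    · exact h
    · exact absurd ⟨_, hR1, huv.2.1⟩ h.1

theorem lemmaA (k : ℕ) (hk : 3 ≤ k) (η : ℝ) (hη : 0 < η) : ∃ n0 : ℕ, ∀ (n : ℕ), n0 ≤ n →
    ∀ G : SimpleGraph (Fin n), ∃ H : SimpleGraph (Fin n), H ≤ G ∧
      (#((univ : Finset (Fin n × Fin n)).filter fun p => G.Adj p.1 p.2 ∧ ¬ H.Adj p.1 p.2) : ℝ)
        ≤ η * n ^ 2 ∧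
      ∀ u v t x y, H.Adj u v → (u = t ∨ H.Adj u t) → H.Adj t x → H.Adj x y → H.Adj y t →
        occursInC G (2 * k + 1) s(u, v) := by
  set e : ℝ := min 1 (η / 25) with hedef
  have he : 0 < e := by simp only [hedef, lt_min_iff]; constructor <;> linarith
  have he1 : e ≤ 1 := min_le_left _ _
  have heη : 25 * e ≤ η := by
    have : e ≤ η / 25 := min_le_right _ _
    linarith
  set l := ⌈4 / e⌉₊
  set M := SzemerediRegularity.bound e l
  have hM : 0 < M := SzemerediRegularity.bound_pos _ _
  set N := ⌈((2 * k : ℕ) + 2 : ℝ) / e ^ 2⌉₊ with hN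
  refine ⟨l + M * N + 1, fun n hn G => ?_⟩
  have hnp : 0 < n := by omega
  have : Nonempty (Fin n) := ⟨⟨0, hnp⟩⟩
  obtain ⟨P, hP, hP1, hP2, hP3⟩ := szemeredi_regularity G he
    (show l ≤ Fintype.card (Fin n) by rw [Fintype.card_fin]; omega)
  have := lemmaA_aux G k hk e he he1 P hP hP3 ((Nat.le_ceil _).trans (by exact_mod_cast hP1)) ?_
  · obtain ⟨H, h1, h2, h3⟩ := this
    refine ⟨H, h1, h2.trans ?_, h3⟩
    rw [Fintype.card_fin]
    gcongr
  · intro X hX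
    have h1 := hP.average_le_card_part hX
    rw [card_univ, Fintype.card_fin] at h1
    have h2 : N ≤ n / #P.parts := by
      have hpos : 0 < #P.parts := card_pos.2 ⟨X, hX⟩
      rw [Nat.le_div_iff_mul_le hpos]
      calc N * #P.parts ≤ N * M := Nat.mul_le_mul_left _ hP2
        _ ≤ n := by rw [mul_comm]; omega
    have h3 : (N : ℝ) ≤ #X := by exact_mod_cast h2.trans h1
    have h4 : ((2 * k : ℕ) + 2 : ℝ) / e ^ 2 ≤ #X := (Nat.le_ceil _).trans h3
    rw [div_le_iff₀ (by positivity)] at h4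
    linarith

end regularityA

section counting
open Finset

/-- number of neighbours of `v` in `B` -/
noncomputable def dg {V : Type*} (G : SimpleGraph V) (v : V) (B : Finset V) : ℕ :=
  #(B.filter (G.Adj v))

/-- number of ordered adjacent pairs -/
noncomputable def eo {V : Type*} (G : SimpleGraph V) (A B : Finset V) : ℕ :=
  ∑ a ∈ A, dg G a B

variable {V : Type*} {G : SimpleGraph V}

theorem dg_le (v : V) (B : Finset V) : dg G v B ≤ #B := card_filter_le _ _

theorem dg_mono (v : V) {B C : Finset V} (h : B ⊆ C) : dg G v B ≤ dg G v C :=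
  card_le_card (filter_subset_filter _ h)

theorem dg_union [DecidableEq V] (v : V) {B C : Finset V} (h : Disjoint B C) :
    dg G v (B ∪ C) = dg G v B + dg G v C := by
  unfold dg
  rw [filter_union, card_union_of_disjoint (disjoint_filter_filter h)]

theorem dg_union_le [DecidableEq V] (v : V) (B C : Finset V) :
    dg G v (B ∪ C) ≤ dg G v B + dg G v C := by
  unfold dg
  rw [filter_union]; exact card_union_le _ _

theorem dg_sdiff [DecidableEq V] (v : V) {B C : Finset V} (h : B ⊆ C) :
    dg G v C = dg G v B + dg G v (C \ B) := by
  rw [← dg_union v disjoint_sdiff, union_sdiff_of_subset h]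

theorem dg_eq_zero {v : V} {B : Finset V} (h : ∀ b ∈ B, ¬ G.Adj v b) : dg G v B = 0 := by
  unfold dg
  rw [card_eq_zero, filter_eq_empty_iff]
  exact fun {b} hb => h b hb

theorem eo_symm (A B : Finset V) : eo G A B = eo G B A := by
  unfold eo dg
  simp_rw [card_filter]
  rw [sum_comm]
  simp_rw [G.adj_comm]

theorem eo_le_of_dg {A B : Finset V} {c : ℕ} (h : ∀ a ∈ A, dg G a B ≤ c) : eo G A B ≤ #A * c := by
  unfold eo
  calc _ ≤ ∑ a ∈ A, c := sum_le_sum h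
    _ = _ := by rw [sum_const, smul_eq_mul]

theorem eo_le (A B : Finset V) : eo G A B ≤ #A * #B := eo_le_of_dg fun a _ => dg_le a B

theorem eo_union_left [DecidableEq V] {A A' : Finset V} (B : Finset V) (h : Disjoint A A') :
    eo G (A ∪ A') B = eo G A B + eo G A' B := sum_union h

theorem eo_union_right [DecidableEq V] (A : Finset V) {B B' : Finset V} (h : Disjoint B B') :
    eo G A (B ∪ B') = eo G A B + eo G A B' := by
  rw [eo_symm, eo_union_left _ h, eo_symm B, eo_symm B']

theorem eo_mono {A A' B B' : Finset V} (h : A ⊆ A') (h' : B ⊆ B') : eo G A B ≤ eo G A' B' := by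
  unfold eo
  calc _ ≤ ∑ a ∈ A, dg G a B' := sum_le_sum fun a _ => dg_mono a h'
    _ ≤ _ := sum_le_sum_of_subset h

theorem eo_mono_graph {H : SimpleGraph V} (h : H ≤ G) (A B : Finset V) : eo H A B ≤ eo G A B := by
  unfold eo dg
  refine sum_le_sum fun a _ => card_le_card fun b hb => ?_
  simp only [mem_filter] at hb ⊢
  exact ⟨hb.1, h hb.2⟩

theorem eo_eq_zero {A B : Finset V} (h : ∀ a ∈ A, ∀ b ∈ B, ¬ G.Adj a b) : eo G A B = 0 :=
  sum_eq_zero fun a ha => dg_eq_zero (h a ha)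

/-- splitting the ordered count of a union -/
theorem eo_union_self [DecidableEq V] {A B : Finset V} (h : Disjoint A B) :
    eo G (A ∪ B) (A ∪ B) = eo G A A + 2 * eo G A B + eo G B B := by
  rw [eo_union_left _ h, eo_union_right _ h, eo_union_right _ h, eo_symm B A]; ring

theorem furedi [DecidableEq V] (S : Finset V)
    (hS : ∀ x ∈ S, ∀ y ∈ S, ∀ z ∈ S, G.Adj x y → G.Adj y z → G.Adj z x → False) :
    ∃ A B : Finset V, Disjoint A B ∧ A ∪ B = S ∧ 2 * eo G S S ≤ 2 * eo G A B + (#S : ℝ) ^ 2 / 2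
      ∧ (eo G S S : ℝ) ≤ (#S : ℝ) ^ 2 / 2 := by
  rcases S.eq_empty_or_nonempty with rfl | hne
  · exact ⟨∅, ∅, by simp, by simp, by simp [eo], by simp [eo]⟩
  obtain ⟨v, hv, hmax⟩ := exists_max_image S (fun v => dg G v S) hne
  set A := S.filter (G.Adj v) with hA
  set B := S \ A with hB
  have hAS : A ⊆ S := filter_subset _ _
  have hd : Disjoint A B := disjoint_sdiff
  have hAB : A ∪ B = S := union_sdiff_of_subset hAS
  have hAA : eo G A A = 0 := by
    refine eo_eq_zero fun a ha b hb hab => ?_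
    rw [hA, mem_filter] at ha hb
    exact hS v hv a ha.1 b hb.1 ha.2 hab hb.2.symm
  have h1 : eo G S S = 2 * eo G A B + eo G B B := by
    conv_lhs => rw [← hAB]
    rw [eo_union_self hd, hAA]; ring
  have h2 : eo G B S = eo G A B + eo G B B := by
    rw [← hAB, eo_union_right _ hd, eo_symm B A]
  have h3 : eo G B S ≤ #B * #A := eo_le_of_dg fun b hb => hmax b (sdiff_subset hb)
  have h4 : #A + #B = #S := by rw [← hAB, card_union_of_disjoint hd]
  have h5 : (eo G B S : ℝ) ≤ (#S : ℝ) ^ 2 / 4 := by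
    have : (eo G B S : ℝ) ≤ #B * #A := by exact_mod_cast h3
    have h4' : (#A : ℝ) + #B = #S := by exact_mod_cast h4
    rw [← h4']
    nlinarith [sq_nonneg ((#A : ℝ) - #B)]
  have h1' : (eo G S S : ℝ) = 2 * eo G A B + eo G B B := by exact_mod_cast h1
  have h2' : (eo G B S : ℝ) = eo G A B + eo G B B := by exact_mod_cast h2
  have h6 : (0:ℝ) ≤ eo G B B := Nat.cast_nonneg _
  exact ⟨A, B, hd, hAB, by linarith, by linarith⟩

theorem num_case (η t u w : ℝ) (hη : 0 < η) (hη1 : η ≤ 1/10000) (ht : 0 ≤ t) (hu : 0 ≤ u)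
    (hw : 1/3 - 12 * η ≤ w) (hs : t + u + w = 1) (h : 1/2 - η ≤ t^2 + u^2 + (1-t)^2/2)
    (ht2 : 0.28 ≤ t) : 2/3 - 675 * η ≤ t := by
  by_contra! hc
  have hu2 : u ≤ 2/3 - t + 12 * η := by linarith
  have h1 : u^2 ≤ (2/3 - t + 12*η)^2 := by gcongr
  have h2 : (2/3 - t + 12*η)^2 ≤ (2/3-t)^2 + 20 * η := by nlinarith
  nlinarith [mul_nonneg (by linarith : 0 ≤ 2/3 - 675*η - t) (by linarith : 0 ≤ t - 0.28)]

theorem num_case2 (η t u m : ℝ) (hη : 0 < η) (hη1 : η ≤ 1/10000) (hm : 0 ≤ m) (hm1 : m ≤ 0.28)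
    (h : 1/2 - η ≤ (1-m)^2/2 + 2 * m * (t + u/3)) (h3 : t + u/3 ≤ 0.409 + 4 * η) :
    m ≤ 25 * η := by
  have h4 : m * (t + u/3) ≤ m * (0.409 + 4 * η) := by gcongr
  nlinarith [mul_nonneg hm (by linarith : 0 ≤ 0.28 - m), mul_nonneg hm (by linarith : 0 ≤ 1/10000 - η)]

theorem num_case3 (m : ℝ) (hm : 0 ≤ m) (hm1 : m ≤ 1) : (1-m)^2 ≤ 1 := by nlinarith

theorem num_case4 (η w : ℝ) (hη : 0 < η) (hη1 : η ≤ 1/10000) (hw : 0 ≤ w)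
    (h : 1/18 - 2 * η ≤ w^2/2) : 1/3 - 12 * η ≤ w := by
  by_contra! hc
  nlinarith

theorem num_case5 (η t : ℝ) (hη : 0 < η) (hη1 : η ≤ 1/10000) (ht : 0 ≤ t)
    (h : t ≤ 1/3 + 675 * η) : t^2 ≤ 1/9 + 500 * η := by
  nlinarith

theorem num_case6 (d c u e1 e2 : ℝ) (h1 : e1 ≤ 2 * (d * c) + c * c) (h2 : e2 ≤ u * d) :
    e1 + 2 * e2 ≤ (d + c)^2 + u^2 := by
  nlinarith [sq_nonneg (d - u)]

set_option maxHeartbeats 2000000 in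
theorem lemmaC [Fintype V] [DecidableEq V] (H : SimpleGraph V) (η : ℝ) (hη : 0 < η)
    (hη1 : η ≤ 1/10000) (hn0 : 0 < Fintype.card V)
    (T W : Finset V)
    (hT : ∀ t, t ∈ T ↔ ∃ x y, H.Adj t x ∧ H.Adj x y ∧ H.Adj y t)
    (hW : ∀ w, w ∈ W ↔ w ∉ T ∧ ∀ t ∈ T, ¬ H.Adj w t)
    (he : (1/2 - η) * (Fintype.card V : ℝ)^2 ≤ eo H univ univ)
    (hb : (1/18 - 2*η) * (Fintype.card V : ℝ)^2 ≤ eo H W W) :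
    (∃ A B : Finset V, Disjoint A B ∧ (1/4 - 51 * η) * (Fintype.card V : ℝ)^2 ≤ eo H A B) ∨
    (∃ T A B : Finset V, Disjoint T (A ∪ B) ∧ Disjoint A B ∧
      (4/9 - 2000 * η) * (Fintype.card V : ℝ)^2 ≤ eo H T T ∧
      (#T : ℝ) ≤ (2/3 + 12 * η) * Fintype.card V ∧
      (1/36 - 2000 * η) * (Fintype.card V : ℝ)^2 ≤ eo H A B ∧
      (#A + #B : ℝ) ≤ (1/3 + 675 * η) * Fintype.card V) := by
  set n : ℝ := (Fintype.card V : ℝ) with hn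
  have hnp : 0 < n := by rw [hn]; exact_mod_cast hn0
  set R := univ \ T with hR
  set U := R \ W with hU
  have hWR : W ⊆ R := by
    intro w hw; rw [hR, mem_sdiff]; exact ⟨mem_univ _, ((hW w).1 hw).1⟩
  have hUW : Disjoint W U := disjoint_sdiff
  have hUWR : W ∪ U = R := union_sdiff_of_subset hWR
  have hTR : Disjoint T R := disjoint_sdiff
  have hTRu : T ∪ R = univ := union_sdiff_of_subset (subset_univ _)
  have hRtri : ∀ x ∈ R, ∀ y, ∀ z, H.Adj x y → H.Adj y z → H.Adj z x → False := by
    intro x hx y z h1 h2 h3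
    rw [hR, mem_sdiff] at hx
    exact hx.2 ((hT x).2 ⟨y, z, h1, h2, h3⟩)
  have c1 : (#T : ℝ) + #R = n := by
    rw [hn, ← card_univ, ← hTRu, card_union_of_disjoint hTR]; push_cast; rfl
  have c2 : (#W : ℝ) + #U = #R := by
    rw [← hUWR, card_union_of_disjoint hUW]; push_cast; rfl
  have hTW : eo H T W = 0 := eo_eq_zero fun t ht w hw h => ((hW w).1 hw).2 t ht h.symm
  have hTR' : eo H T R = eo H T U := by
    rw [← hUWR, eo_union_right _ hUW, hTW, zero_add]
  have htot : eo H univ univ = eo H T T + 2 * eo H T U + eo H R R := by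
    rw [← hTRu, eo_union_self hTR, hTR']
  obtain ⟨_, _, _, _, _, hRR⟩ := furedi (G := H) R (fun x hx y _ z _ => hRtri x hx y z)
  obtain ⟨A, B, hAB, hABW, hW1, hW2⟩ := furedi (G := H) W (fun x hx y _ z _ => hRtri x (hWR hx) y z)
  -- normalise
  obtain ⟨t, ht⟩ : ∃ t, t * n = #T := ⟨#T / n, by field_simp⟩
  obtain ⟨u, hu⟩ : ∃ t, t * n = #U := ⟨#U / n, by field_simp⟩
  obtain ⟨w, hw⟩ : ∃ t, t * n = #W := ⟨#W / n, by field_simp⟩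
  have ht0 : 0 ≤ t := nonneg_of_mul_nonneg_left (by rw [ht]; positivity) hnp
  have hu0 : 0 ≤ u := nonneg_of_mul_nonneg_left (by rw [hu]; positivity) hnp
  have hw0 : 0 ≤ w := nonneg_of_mul_nonneg_left (by rw [hw]; positivity) hnp
  have hsum : t + u + w = 1 := by
    have : (t + u + w) * n = 1 * n := by linarith
    exact mul_right_cancel₀ hnp.ne' this
  have hrn : (#R : ℝ) = (1 - t) * n := by linarith
  have hn2 : 0 < n^2 := by positivity
  have hwlow : 1/3 - 12 * η ≤ w := by
    have h1 : (1/18 - 2*η) * n^2 ≤ (w^2/2) * n^2 := by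
      calc _ ≤ _ := hb
        _ ≤ _ := hW2
        _ = _ := by rw [← hw]; ring
    have h2 := le_of_mul_le_mul_right h1 hn2
    exact num_case4 η w hη hη1 hw0 h2
  have hne : T.Nonempty ∨ T = ∅ := by
    rcases T.eq_empty_or_nonempty with h | h
    · right; exact h
    · left; exact h
  have hquad : 1/2 - η ≤ t^2 + u^2 + (1-t)^2/2 := by
    have key : (eo H T T : ℝ) + 2 * eo H T U ≤ (#T : ℝ)^2 + (#U : ℝ)^2 := by
      rcases U.eq_empty_or_nonempty with hUe | hUne
      · have : (eo H T T : ℝ) ≤ #T * #T := by exact_mod_cast eo_le T T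
        rw [hUe]; simp only [eo, dg]; simp
        unfold eo dg at this
        push_cast at this
        nlinarith
      · obtain ⟨v, hv, hmax⟩ := exists_max_image U (fun v => dg H v T) hUne
        set D := T.filter (H.Adj v) with hD
        have hvR : v ∈ R := (mem_sdiff.1 hv).1
        have hDD : eo H D D = 0 := by
          refine eo_eq_zero fun a ha b hb hab => ?_
          rw [hD, mem_filter] at ha hb
          exact hRtri v hvR a b ha.2 hab hb.2.symm
        have hDT : D ⊆ T := filter_subset _ _
        have hc : #D + #(T \ D) = #T := by
          rw [← card_union_of_disjoint disjoint_sdiff, union_sdiff_of_subset hDT]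
        have e1 : eo H T T = 2 * eo H D (T \ D) + eo H (T \ D) (T \ D) := by
          conv_lhs => rw [← union_sdiff_of_subset hDT]
          rw [eo_union_self disjoint_sdiff, hDD]; ring
        have e2 : eo H T U ≤ #U * #D := by
          rw [eo_symm]; exact eo_le_of_dg fun b hb => hmax b hb
        have e3 := eo_le (G := H) D (T \ D)
        have e4 := eo_le (G := H) (T \ D) (T \ D)
        have e1' : (eo H T T : ℝ) ≤ 2 * (#D * #(T \ D)) + #(T \ D) * #(T \ D) := by
          exact_mod_cast (by omega : eo H T T ≤ 2 * (#D * #(T \ D)) + #(T \ D) * #(T \ D))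
        have e2' : (eo H T U : ℝ) ≤ #U * #D := by exact_mod_cast e2
        have hc' : (#D : ℝ) + #(T \ D) = #T := by exact_mod_cast hc
        rw [← hc']
        exact num_case6 _ _ _ _ _ e1' e2'
    have h1 : (1/2 - η) * n^2 ≤ (t^2 + u^2 + (1-t)^2/2) * n^2 := by
      have : (eo H univ univ : ℝ) = eo H T T + 2 * eo H T U + eo H R R := by exact_mod_cast htot
      rw [hrn] at hRR
      rw [← ht, ← hu] at key
      linarith
    exact le_of_mul_le_mul_right h1 hn2
  by_cases htc : 0.28 ≤ t
  · right
    have htl := num_case η t u w hη hη1 ht0 hu0 hwlow hsum hquad htc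
    have huu : u ≤ 687 * η := by linarith
    refine ⟨T, A, B, ?_, hAB, ?_, ?_, ?_, ?_⟩
    · rw [hABW]; exact hTR.mono_right hWR
    · have : (eo H univ univ : ℝ) = eo H T T + 2 * eo H T U + eo H R R := by exact_mod_cast htot
      have h2 : (eo H T U : ℝ) ≤ (t * n) * (u * n) := by
        rw [ht, hu]; exact_mod_cast eo_le T U
      rw [hrn] at hRR
      have h3 : t * u ≤ 0.7 * (687 * η) := by
        apply mul_le_mul _ huu hu0 (by norm_num); linarith
      have h4 : (1 - t)^2 ≤ 1/9 + 500 * η :=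
        num_case5 η _ hη hη1 (by linarith) (by linarith)
      have h5 : 4/9 - 2000 * η ≤ 1/2 - η - 2 * (t * u) - (1 - t)^2/2 := by linarith
      have h6 := mul_le_mul_of_nonneg_right h5 hn2.le
      linarith
    · rw [← ht]
      apply mul_le_mul_of_nonneg_right _ hnp.le
      linarith
    · rw [← hw] at hW1
      have h4 : w^2 ≤ 1/9 + 500 * η :=
        num_case5 η _ hη hη1 (by linarith) (by linarith)
      have h5 : 1/36 - 2000 * η ≤ 1/18 - 2 * η - w^2/4 := by linarith
      have h6 := mul_le_mul_of_nonneg_right h5 hn2.le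
      linarith
    · have : (#A + #B : ℝ) = #W := by
        rw [← hABW, card_union_of_disjoint hAB]; push_cast; rfl
      rw [this, ← hw]
      apply mul_le_mul_of_nonneg_right _ hnp.le
      linarith
  · left
    push Not at htc
    obtain ⟨X, hX, hXmax⟩ := exists_max_image
      (T.powerset.filter fun X => 3 * eo H X univ ≤ #X * (3 * #T + #U)) (fun X => #X)
      ⟨∅, by rw [mem_filter, mem_powerset]; exact ⟨empty_subset _, by simp [eo]⟩⟩
    rw [mem_filter, mem_powerset] at hX
    set S := univ \ X with hS
    have hXS : Disjoint X S := disjoint_sdiff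
    have hXSu : X ∪ S = univ := union_sdiff_of_subset (subset_univ _)
    have hStri : ∀ x ∈ S, ∀ y ∈ S, ∀ z ∈ S, H.Adj x y → H.Adj y z → H.Adj z x → False := by
      have hdeg : ∀ x y z, H.Adj x y → H.Adj y z → H.Adj z x →
          dg H x univ + dg H y univ + dg H z univ ≤ 3 * #T + #U := by
        intro x y z h1 h2 h3
        have hx : x ∈ T := (hT x).2 ⟨y, z, h1, h2, h3⟩
        have hy : y ∈ T := (hT y).2 ⟨z, x, h2, h3, h1⟩
        have hz : z ∈ T := (hT z).2 ⟨x, y, h3, h1, h2⟩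
        have hd : ∀ v ∈ T, dg H v univ ≤ #T + dg H v U := by
          intro v hv
          rw [← hTRu, dg_union v hTR, ← hUWR, dg_union v hUW]
          have : dg H v W = 0 := dg_eq_zero fun w hw h => ((hW w).1 hw).2 v hv h.symm
          have := dg_le (G := H) v T
          omega
        have hU3 : dg H x U + dg H y U + dg H z U ≤ #U := by
          have dis : ∀ a b, H.Adj a b → Disjoint (U.filter (H.Adj a)) (U.filter (H.Adj b)) := by
            intro a b hab
            rw [Finset.disjoint_left]
            intro c hc hc'
            rw [mem_filter] at hc hc'
            exact hRtri c (mem_sdiff.1 hc.1).1 a b hc.2.symm hab hc'.2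
          unfold dg
          rw [← card_union_of_disjoint (dis _ _ h1), ← card_union_of_disjoint]
          · apply card_le_card
            intro c hc
            simp only [mem_union, mem_filter] at hc
            tauto
          · rw [disjoint_union_left]
            exact ⟨dis _ _ h3.symm, dis _ _ h2⟩
        have := hd x hx
        have := hd y hy
        have := hd z hz
        omega
      have hadd : ∀ x ∈ S, x ∈ T → 3 * dg H x univ ≤ 3 * #T + #U → False := by
        intro x hxS hxT hdx
        have hxX : x ∉ X := (mem_sdiff.1 hxS).2
        have := hXmax (insert x X) (by
          rw [mem_filter, mem_powerset]
          refine ⟨insert_subset hxT hX.1, ?_⟩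
          unfold eo
          rw [sum_insert hxX, card_insert_of_notMem hxX]
          have := hX.2
          unfold eo at this
          rw [add_mul, mul_add, one_mul]
          omega)
        rw [card_insert_of_notMem hxX] at this
        omega
      intro x hx y hy z hz h1 h2 h3
      have hxT : x ∈ T := (hT x).2 ⟨y, z, h1, h2, h3⟩
      have hyT : y ∈ T := (hT y).2 ⟨z, x, h2, h3, h1⟩
      have hzT : z ∈ T := (hT z).2 ⟨x, y, h3, h1, h2⟩
      have := hdeg x y z h1 h2 h3
      have hor : 3 * dg H x univ ≤ 3 * #T + #U ∨ 3 * dg H y univ ≤ 3 * #T + #U ∨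
        3 * dg H z univ ≤ 3 * #T + #U := by omega
      rcases hor with h | h | h
      · exact hadd x hx hxT h
      · exact hadd y hy hyT h
      · exact hadd z hz hzT h
    obtain ⟨A, B, hAB', hABS, hS1, hS2⟩ := furedi (G := H) S hStri
    refine ⟨A, B, hAB', ?_⟩
    obtain ⟨m, hm⟩ : ∃ t, t * n = #X := ⟨#X / n, by field_simp⟩
    have hm0 : 0 ≤ m := nonneg_of_mul_nonneg_left (by rw [hm]; positivity) hnp
    have hmt : m ≤ t := by
      have : m * n ≤ t * n := by rw [hm, ht]; exact_mod_cast card_le_card hX.1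
      exact le_of_mul_le_mul_right this hnp
    have hs : (#S : ℝ) = (1 - m) * n := by
      have : (#X : ℝ) + #S = n := by
        rw [hn, ← card_univ, ← hXSu, card_union_of_disjoint hXS]; push_cast; rfl
      linarith
    have hX2 : 3 * (eo H X univ : ℝ) ≤ (m * n) * (3 * (t * n) + u * n) := by
      rw [hm, ht, hu]; exact_mod_cast hX.2
    have htot2 : (eo H univ univ : ℝ) ≤ 2 * eo H X univ + eo H S S := by
      have h1 : eo H univ univ = eo H X X + 2 * eo H X S + eo H S S := by
        rw [← hXSu, eo_union_self hXS]
      have h2 : eo H X univ = eo H X X + eo H X S := by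
        rw [← hXSu, eo_union_right _ hXS]
      exact_mod_cast (by omega : eo H univ univ ≤ 2 * eo H X univ + eo H S S)
    have hXb : (eo H X univ : ℝ) ≤ (m * n) * n := by
      rw [hm, hn, ← card_univ]; exact_mod_cast eo_le X univ
    rw [hs] at hS1 hS2
    have hmη : m ≤ 25 * η := by
      have h1 : (1/2 - η) * n^2 ≤ ((1-m)^2/2 + 2 * m * (t + u/3)) * n^2 := by linarith
      have h2 := le_of_mul_le_mul_right h1 hn2
      exact num_case2 η t u m hη hη1 hm0 (by linarith) h2 (by linarith)
    have h5 : (1 - m)^2 ≤ 1 := num_case3 m hm0 (by linarith)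
    have h6 : ((1 - m) * n)^2 ≤ n^2 := by
      rw [mul_pow]
      have := mul_le_mul_of_nonneg_right h5 hn2.le
      linarith
    have h7 : (m * n) * n ≤ 25 * η * n^2 := by
      have := mul_le_mul_of_nonneg_right hmη hn2.le
      linarith
    linarith

end counting

section paths
open Finset

variable {V : Type*} [DecidableEq V] {G : SimpleGraph V}

theorem pick {v : V} {B F : Finset V} (h : #F < dg G v B) : ∃ z ∈ B, G.Adj v z ∧ z ∉ F := by
  obtain ⟨z, hz, hzF⟩ := exists_mem_notMem_of_card_lt_card h
  rw [mem_filter] at hz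
  exact ⟨z, hz.1, hz.2, hzF⟩

theorem pick2 {p v : V} {B F : Finset V} {D : ℕ} (hp : #B ≤ dg G p B + D)
    (h : D + #F < dg G v B) : ∃ z ∈ B, G.Adj p z ∧ G.Adj v z ∧ z ∉ F := by
  have h1 : dg G v B ≤ dg G p (B.filter (G.Adj v)) + D := by
    have e1 := dg_sdiff (G := G) p (filter_subset (G.Adj v) B)
    have e2 := dg_le (G := G) p (B \ B.filter (G.Adj v))
    have e3 := card_sdiff_add_card_eq_card (filter_subset (G.Adj v) B)
    unfold dg at *
    omega
  obtain ⟨z, hz, hpz, hzF⟩ := pick (G := G) (v := p) (B := B.filter (G.Adj v)) (F := F) (by omega)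
  rw [mem_filter] at hz
  exact ⟨z, hz.1, hpz, hz.2, hzF⟩

theorem dense_path {D : ℕ} (j : ℕ) : ∀ (A B : Finset V), (∀ a ∈ A, #B ≤ dg G a B + D) →
    (∀ b ∈ B, #A ≤ dg G b A + D) → ∀ (x y : V) (F : Finset V), x ∈ A → x ∉ F → y ∉ F → x ≠ y →
    D + #F + (j + 2) < #A → D + #F + (j + 2) < #B →
    D + #F + (j + 2) < dg G y (if Even j then B else A) → Pth G (j + 2) x y F := by
  induction j with
  | zero =>
    intro A B hA hB x y F hx hxF hyF hxy h1 h2 h3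
    simp only [Even.zero, if_true] at h3
    obtain ⟨z, hz, hxz, hyz, hzF⟩ := pick2 (hA x hx) (F := F) (by omega : D + #F < dg G y B)
    refine ⟨hxF, z, hxz, ?_, y, hyz.symm, rfl, ?_⟩
    · simp only [mem_insert, not_or]; exact ⟨hxz.ne', hzF⟩
    · simp only [mem_insert, not_or]; exact ⟨hyz.ne, hxy.symm, hyF⟩
  | succ j ih =>
    intro A B hA hB x y F hx hxF hyF hxy h1 h2 h3
    have hxB := hA x hx
    have hc := card_insert_le y F
    obtain ⟨z, hz, hxz, hzF⟩ := pick (G := G) (v := x) (B := B) (F := insert y F) (by omega)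
    simp only [mem_insert, not_or] at hzF
    have hc' := card_insert_le x F
    refine ⟨hxF, z, hxz, ih B A hB hA z y (insert x F) hz ?_ ?_ hzF.1 (by omega) (by omega) ?_⟩
    · simp only [mem_insert, not_or]; exact ⟨hxz.ne', hzF.2⟩
    · simp only [mem_insert, not_or]; exact ⟨hxy.symm, hyF⟩
    · have : (if Even j then A else B) = (if Even (j+1) then B else A) := by
        by_cases hj : Even j
        · have : ¬ Even (j+1) := by rw [Nat.even_add_one]; simpa using hj
          simp [hj, this]
        · have : Even (j+1) := by rw [Nat.even_add_one]; exact hj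
          simp [hj, this]
      rw [this]; omega

/-- dense bipartite core -/
structure Core (G : SimpleGraph V) (D c : ℕ) (P Q : Finset V) : Prop where
  dis : Disjoint P Q
  hP : ∀ p ∈ P, #Q ≤ dg G p Q + D
  hQ : ∀ q ∈ Q, #P ≤ dg G q P + D
  cP : D + c + D < #P
  cQ : D + c + D < #Q

theorem Core.symm {D c : ℕ} {P Q : Finset V} (h : Core G D c P Q) : Core G D c Q P :=
  ⟨h.dis.symm, h.hQ, h.hP, h.cQ, h.cP⟩

theorem Core.even_path {D c : ℕ} {P Q : Finset V} (h : Core G D c P Q) {i : ℕ} (hi : 1 ≤ i)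
    {x y : V} {F : Finset V} (hx : x ∈ P) (hxF : x ∉ F) (hyF : y ∉ F) (hxy : x ≠ y)
    (hF : #F + 2 * i ≤ c) (hy : D + c < dg G y Q) : Pth G (2 * i) x y F := by
  have := dense_path (G := G) (D := D) (2 * i - 2) P Q h.hP h.hQ x y F hx hxF hyF hxy
    (by have := h.cP; omega) (by have := h.cQ; omega) (by
      have : Even (2 * i - 2) := by
        obtain ⟨m, rfl⟩ : ∃ m, i = m + 1 := ⟨i - 1, by omega⟩
        exact ⟨m, by omega⟩
      rw [if_pos this]; omega)
  rwa [show 2 * i - 2 + 2 = 2 * i by omega] at this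

theorem Core.odd_path {D c : ℕ} {P Q : Finset V} (h : Core G D c P Q) {i : ℕ} (hi : 1 ≤ i)
    {x y : V} {F : Finset V} (hx : x ∈ P) (hxF : x ∉ F) (hyF : y ∉ F) (hxy : x ≠ y)
    (hF : #F + (2 * i + 1) ≤ c) (hy : D + c < dg G y P) : Pth G (2 * i + 1) x y F := by
  have := dense_path (G := G) (D := D) (2 * i - 1) P Q h.hP h.hQ x y F hx hxF hyF hxy
    (by have := h.cP; omega) (by have := h.cQ; omega) (by
      have : ¬ Even (2 * i - 1) := by
        obtain ⟨m, rfl⟩ : ∃ m, i = m + 1 := ⟨i - 1, by omega⟩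
        rw [Nat.not_even_iff_odd]
        exact ⟨m, by omega⟩
      rw [if_neg this]; omega)
  rwa [show 2 * i - 1 + 2 = 2 * i + 1 by omega] at this

/-- adjacent vertices both rich in `Q` make core edges red -/
theorem claimI {D c k : ℕ} {P Q : Finset V} (h : Core G D c P Q) (hk : 3 ≤ k) (hc : 2 * k + 10 ≤ c)
    {v v' p q : V} (hvv : G.Adj v v') (hv : D + c < dg G v Q) (hv' : D + c < dg G v' Q)
    (hp : p ∈ P) (hq : q ∈ Q) (hpq : G.Adj p q) (h1 : p ≠ v) (h2 : p ≠ v') (h3 : q ≠ v)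
    (h4 : q ≠ v') : occursInC G (2 * k + 1) s(p, q) := by
  apply red_of_Pth (by omega) hpq
  obtain ⟨q1, hq1, hpq1, hvq1, hq1F⟩ := pick2 (F := {v, q}) (h.hP p hp) (v := v') (by
    have := card_le_two (a := v) (b := q); omega)
  simp only [mem_insert, mem_singleton, not_or] at hq1F
  have hpath : Pth G (2 * (k - 2) + 1) v q {v', q1, p} := by
    refine Pth_symm (h.symm.odd_path (by omega) hq ?_ ?_ h3 ?_ hv)
    · simp only [mem_insert, mem_singleton, not_or]
      exact ⟨h4, Ne.symm hq1F.2, hpq.ne'⟩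
    · simp only [mem_insert, mem_singleton, not_or]
      exact ⟨hvv.ne, Ne.symm hq1F.1, Ne.symm h1⟩
    · have := card_le_three (a := v') (b := q1) (c := p); omega
  have : Pth G (2 * (k - 2) + 1 + 1 + 1 + 1) p q ∅ := by
    refine Pth_cons (by simp) hpq1 (Pth_cons ?_ hvq1.symm (Pth_cons ?_ hvv.symm hpath))
    · simp; exact hpq1.ne'
    · simp; exact ⟨hvq1.ne, Ne.symm h2⟩
  rwa [show 2 * (k - 2) + 1 + 1 + 1 + 1 = 2 * k by omega] at this

theorem claimII {D c k : ℕ} {P Q : Finset V} (h : Core G D c P Q) (hk : 3 ≤ k) (hc : 2 * k + 10 ≤ c)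
    {v p q : V} (hv : D + c < dg G v Q) (hv' : D + c < dg G v P)
    (hp : p ∈ P) (hq : q ∈ Q) (hpq : G.Adj p q) (h1 : p ≠ v) (h3 : q ≠ v) :
    occursInC G (2 * k + 1) s(p, q) := by
  apply red_of_Pth (by omega) hpq
  obtain ⟨q1, hq1, hpq1, hvq1, hq1F⟩ := pick2 (F := {q}) (h.hP p hp) (v := v) (by
    have := card_singleton q; omega)
  simp only [mem_singleton] at hq1F
  have hpath : Pth G (2 * (k - 1)) v q {q1, p} := by
    refine Pth_symm (h.symm.even_path (by omega) hq ?_ ?_ h3 ?_ hv')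
    · simp only [mem_insert, mem_singleton, not_or]
      exact ⟨Ne.symm hq1F, hpq.ne'⟩
    · simp only [mem_insert, mem_singleton, not_or]
      exact ⟨hvq1.ne, Ne.symm h1⟩
    · have := card_le_two (a := q1) (b := p); omega
  have : Pth G (2 * (k - 1) + 1 + 1) p q ∅ := by
    refine Pth_cons (by simp) hpq1 (Pth_cons ?_ hvq1.symm hpath)
    simp; exact hpq1.ne'
  rwa [show 2 * (k - 1) + 1 + 1 = 2 * k by omega] at this

theorem claimIII {D c k : ℕ} {P Q : Finset V} (h : Core G D c P Q) (hk : 3 ≤ k)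
    (hc : 2 * k + 10 ≤ c) {v1 a v2 p q : V} (hv1 : D + c < dg G v1 Q) (hv2 : D + c < dg G v2 P)
    (h1a : G.Adj v1 a) (ha2 : G.Adj a v2) (h12 : v1 ≠ v2) (haPQ : a ∉ P ∧ a ∉ Q)
    (hp : p ∈ P) (hq : q ∈ Q) (hpq : G.Adj p q) (h1 : p ≠ v1) (h2 : p ≠ v2) (h3 : q ≠ v1)
    (h4 : q ≠ v2) : occursInC G (2 * k + 1) s(p, q) := by
  apply red_of_Pth (by omega) hpq
  have hap : a ≠ p := by rintro rfl; exact haPQ.1 hp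
  have haq : a ≠ q := by rintro rfl; exact haPQ.2 hq
  obtain ⟨q1, hq1, hpq1, hvq1, hq1F⟩ := pick2 (F := {v2, q}) (h.hP p hp) (v := v1) (by
    have := card_le_two (a := v2) (b := q); omega)
  simp only [mem_insert, mem_singleton, not_or] at hq1F
  have haq1 : a ≠ q1 := by rintro rfl; exact haPQ.2 hq1
  have hpath : Pth G (2 * (k - 2)) v2 q {a, v1, q1, p} := by
    refine Pth_symm (h.symm.even_path (by omega) hq ?_ ?_ h4 ?_ hv2)
    · simp only [mem_insert, mem_singleton, not_or]
      exact ⟨haq.symm, h3, Ne.symm hq1F.2, hpq.ne'⟩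
    · simp only [mem_insert, mem_singleton, not_or]
      exact ⟨ha2.ne', h12.symm, Ne.symm hq1F.1, h2.symm⟩
    · have := card_le_four (a := a) (b := v1) (c := q1) (d := p); omega
  have : Pth G (2 * (k - 2) + 1 + 1 + 1 + 1) p q ∅ := by
    refine Pth_cons (by simp) hpq1 (Pth_cons ?_ hvq1.symm (Pth_cons ?_ h1a (Pth_cons ?_ ha2 hpath)))
    · simp; exact hpq1.ne'
    · simp; exact ⟨hvq1.ne, Ne.symm h1⟩
    · simp; exact ⟨h1a.ne', haq1, hap⟩
  rwa [show 2 * (k - 2) + 1 + 1 + 1 + 1 = 2 * k by omega] at this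

/-- dense clique like core -/
theorem K_path {D c : ℕ} {K : Finset V} (hK : ∀ a ∈ K, #K ≤ dg G a K + D) (cK : D + c < #K)
    {l : ℕ} (hl : 2 ≤ l) {x y : V} {F : Finset V} (hx : x ∈ K) (hxF : x ∉ F) (hyF : y ∉ F)
    (hxy : x ≠ y) (hF : #F + l ≤ c) (hy : D + c < dg G y K) : Pth G l x y F := by
  have := dense_path (G := G) (D := D) (l - 2) K K hK hK x y F hx hxF hyF hxy
    (by omega) (by omega) (by rw [ite_self]; omega)
  rwa [show l - 2 + 2 = l by omega] at this

theorem Z_path {D c : ℕ} {K : Finset V} (hK : ∀ a ∈ K, #K ≤ dg G a K + D) (cK : D + c < #K)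
    {l : ℕ} (hl : 3 ≤ l) {x y : V} {F : Finset V} (hx : D + c < dg G x K) (hxF : x ∉ F)
    (hyF : y ∉ F) (hxy : x ≠ y) (hF : #F + l ≤ c) (hy : D + c < dg G y K) : Pth G l x y F := by
  have hc := card_insert_le y F
  obtain ⟨z, hz, hxz, hzF⟩ := pick (G := G) (v := x) (B := K) (F := insert y F) (by omega)
  simp only [mem_insert, not_or] at hzF
  have hc2 := card_insert_le x F
  have : Pth G (l - 1) z y (insert x F) := by
    refine K_path hK cK (by omega) hz ?_ ?_ hzF.1 (by omega) hy
    · simp only [mem_insert, not_or]; exact ⟨hxz.ne', hzF.2⟩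
    · simp only [mem_insert, not_or]; exact ⟨hxy.symm, hyF⟩
  have := Pth_cons hxF hxz this
  rwa [show l - 1 + 1 = l by omega] at this

theorem Z_red {D c k : ℕ} {K : Finset V} (hK : ∀ a ∈ K, #K ≤ dg G a K + D) (cK : D + c < #K)
    (hk : 3 ≤ k) (hc : 2 * k + 10 ≤ c)
    {x y : V} (hx : D + c < dg G x K) (hy : D + c < dg G y K) (hxy : G.Adj x y) :
    occursInC G (2 * k + 1) s(x, y) :=
  red_of_Pth (by omega) hxy (Z_path hK cK (by omega) hx (by simp) (by simp) hxy.ne (by simp; omega) hy)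

/-- length `2k-4` path between distinct vertices of `Z` with a common neighbour -/
theorem Z_path' {D c k : ℕ} {K : Finset V} (hK : ∀ a ∈ K, #K ≤ dg G a K + D) (cK : D + c < #K)
    (hk : 3 ≤ k) (hc : 2 * k + 10 ≤ c)
    {x y z : V} {F : Finset V} (hx : D + c < dg G x K) (hxF : x ∉ F)
    (hyF : y ∉ F) (hxy : x ≠ y) (hF : #F ≤ 10) (hy : D + c < dg G y K)
    (hxz : G.Adj x z) (hyz : G.Adj y z) (hzF : z ∉ F) : Pth G (2 * k - 4) x y F := by
  rcases Nat.lt_or_ge 3 k with h | h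
  · exact Z_path hK cK (by omega) hx hxF hyF hxy (by omega) hy
  · have : k = 3 := by omega
    subst this
    refine ⟨hxF, z, hxz, ?_, y, hyz.symm, rfl, ?_⟩
    · simp only [mem_insert, not_or]; exact ⟨hxz.ne', hzF⟩
    · simp only [mem_insert, not_or]; exact ⟨hyz.ne, hxy.symm, hyF⟩

theorem claimIVa {D c k : ℕ} {K : Finset V} (hK : ∀ a ∈ K, #K ≤ dg G a K + D) (cK : D + c < #K)
    (hk : 3 ≤ k) (hc : 2 * k + 10 ≤ c)
    {a1 a2 z v1 v2 p q : V} (ha1 : D + c < dg G a1 K) (ha2 : D + c < dg G a2 K) (ha : a1 ≠ a2)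
    (h1z : G.Adj a1 z) (h2z : G.Adj a2 z) (h1 : G.Adj v1 a1) (h2 : G.Adj v2 a2)
    (h1q : G.Adj q v1) (h2p : G.Adj v2 p) (hpq : G.Adj q p)
    (hd : ∀ x ∈ ({a1, a2, z} : Finset V), ∀ y ∈ ({v1, v2, p, q} : Finset V), x ≠ y)
    (h12 : v1 ≠ v2) (h1p : v1 ≠ p) (h2q : v2 ≠ q) : occursInC G (2 * k + 1) s(q, p) := by
  apply red_of_Pth (by omega) hpq
  simp only [mem_insert, mem_singleton, forall_eq_or_imp, forall_eq] at hd
  obtain ⟨⟨d1, d2, d3, d4⟩, ⟨d5, d6, d7, d8⟩, d9, d10, d11, d12⟩ := hd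
  have hpath : Pth G (2 * k - 4) a1 a2 {v2, p, v1, q} := by
    refine Z_path' hK cK hk hc ha1 ?_ ?_ ha (card_le_four.trans (by norm_num)) ha2 h1z h2z ?_
    · simp only [mem_insert, mem_singleton, not_or]; tauto
    · simp only [mem_insert, mem_singleton, not_or]; tauto
    · simp only [mem_insert, mem_singleton, not_or]; tauto
  have : Pth G (2 * k - 4 + 1 + 1 + 1 + 1) q p ∅ := by
    refine Pth_cons (by simp) h1q (Pth_cons ?_ h1 (Pth_snoc ?_ h2p (Pth_snoc ?_ h2.symm hpath)))
    · simp; exact h1q.ne'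
    · simp; exact ⟨h1p.symm, hpq.ne'⟩
    · simp; exact ⟨h2p.ne, h12.symm, h2q⟩
  rwa [show 2 * k - 4 + 1 + 1 + 1 + 1 = 2 * k by omega] at this

theorem claimIVb {D c k : ℕ} {K : Finset V} (hK : ∀ a ∈ K, #K ≤ dg G a K + D) (cK : D + c < #K)
    (hk : 3 ≤ k) (hc : 2 * k + 10 ≤ c)
    {a1 a2 v1 v2 : V} (ha1 : D + c < dg G a1 K) (ha2 : D + c < dg G a2 K) (ha : a1 ≠ a2)
    (h1 : G.Adj v1 a1) (h2 : G.Adj v2 a2) (h12 : G.Adj v1 v2) (h3 : a1 ≠ v2) (h4 : a2 ≠ v1) :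
    occursInC G (2 * k + 1) s(v1, v2) := by
  apply red_of_Pth (by omega) h12
  have hpath : Pth G (2 * k - 2) a1 a2 {v2, v1} := by
    refine Z_path hK cK (by omega) ha1 ?_ ?_ ha ?_ ha2
    · simp only [mem_insert, mem_singleton, not_or]; exact ⟨h3, h1.ne'⟩
    · simp only [mem_insert, mem_singleton, not_or]; exact ⟨h2.ne', h4⟩
    · have := card_le_two (a := v2) (b := v1); omega
  have : Pth G (2 * k - 2 + 1 + 1) v1 v2 ∅ := by
    refine Pth_cons (by simp) h1 (Pth_snoc ?_ h2.symm hpath)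
    simp; exact h12.ne'
  rwa [show 2 * k - 2 + 1 + 1 = 2 * k by omega] at this

theorem claimV {D c k : ℕ} {K : Finset V} (hK : ∀ a ∈ K, #K ≤ dg G a K + D) (cK : D + c < #K)
    (hk : 3 ≤ k) (hc : 2 * k + 10 ≤ c)
    {a1 a2 v1 v2 q : V} (ha1 : D + c < dg G a1 K) (ha2 : D + c < dg G a2 K) (ha : a1 ≠ a2)
    (h1 : G.Adj v1 a1) (h2 : G.Adj v2 a2) (h12 : v1 ≠ v2) (h3 : a1 ≠ v2) (h4 : a2 ≠ v1)
    (h5 : a1 ≠ q) (h6 : a2 ≠ q) (h1q : G.Adj v1 q) (h2q : G.Adj v2 q) :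
    occursInC G (2 * k + 1) s(v1, q) := by
  apply red_of_Pth (by omega) h1q
  have hpath : Pth G (2 * k - 3) a1 a2 {v2, q, v1} := by
    refine Z_path hK cK (by omega) ha1 ?_ ?_ ha ?_ ha2
    · simp only [mem_insert, mem_singleton, not_or]; exact ⟨h3, h5, h1.ne'⟩
    · simp only [mem_insert, mem_singleton, not_or]; exact ⟨h2.ne', h6, h4⟩
    · have := card_le_three (a := v2) (b := q) (c := v1); omega
  have : Pth G (2 * k - 3 + 1 + 1 + 1) v1 q ∅ := by
    refine Pth_cons (by simp) h1 (Pth_snoc ?_ h2q (Pth_snoc ?_ h2.symm hpath))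
    · simp; exact h1q.ne'
    · simp; exact ⟨h2q.ne, h12.symm⟩
  rwa [show 2 * k - 3 + 1 + 1 + 1 = 2 * k by omega] at this

end paths

section cores
open Finset

variable {V : Type*} {G : SimpleGraph V}

/-- the graph of edges not on a cycle of length `2k+1` -/
def Bl (G : SimpleGraph V) (k : ℕ) : SimpleGraph V where
  Adj a b := G.Adj a b ∧ ¬ occursInC G (2 * k + 1) s(a, b)
  symm := ⟨by
    rintro a b ⟨h1, h2⟩
    refine ⟨h1.symm, ?_⟩
    rwa [Sym2.eq_swap]⟩
  loopless := ⟨fun a h => G.loopless.irrefl a h.1⟩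

theorem Bl_le (k : ℕ) : Bl G k ≤ G := fun _ _ h => h.1

theorem eo_eq_card (A B : Finset V) :
    eo G A B = #((A ×ˢ B).filter fun p => G.Adj p.1 p.2) := by
  unfold eo dg
  rw [card_filter, sum_product]
  refine sum_congr rfl fun x _ => ?_
  rw [card_filter]

theorem extract {A B : Finset V} {D : ℕ} (h : #A * #B ≤ eo G A B + D * D) :
    #A ≤ #(A.filter fun a => #B ≤ dg G a B + D) + D := by
  have h1 : eo G A B + #(A.filter fun a => ¬ #B ≤ dg G a B + D) * (D + 1) ≤ #A * #B := by
    unfold eo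
    rw [card_filter, sum_mul, ← sum_add_distrib, ← smul_eq_mul (a := #A), ← sum_const]
    refine sum_le_sum fun a _ => ?_
    have := dg_le (G := G) a B
    split_ifs <;> omega
  have h2 := card_filter_add_card_filter_not (s := A) (fun a => #B ≤ dg G a B + D)
  have h3 : #(A.filter fun a => ¬ #B ≤ dg G a B + D) * (D + 1) ≤ D * D := by omega
  have h4 : #(A.filter fun a => ¬ #B ≤ dg G a B + D) ≤ D := by
    by_contra hc
    rw [not_le] at hc
    have := Nat.mul_le_mul hc (le_refl (D+1))
    nlinarith
  omega

theorem low_deg {A B : Finset V} {D : ℕ} (h : eo G A B ≤ D * D) :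
    #A ≤ #(A.filter fun a => dg G a B ≤ D) + D := by
  have h1 : #(A.filter fun a => ¬ dg G a B ≤ D) * (D + 1) ≤ eo G A B := by
    unfold eo
    rw [card_filter, sum_mul]
    refine sum_le_sum fun a _ => ?_
    split_ifs <;> omega
  have h2 := card_filter_add_card_filter_not (s := A) (fun a => dg G a B ≤ D)
  have h4 : #(A.filter fun a => ¬ dg G a B ≤ D) ≤ D := by
    by_contra hc
    rw [not_le] at hc
    have := Nat.mul_le_mul hc (le_refl (D+1))
    nlinarith
  omega

theorem dg_shrink [DecidableEq V] {a : V} {B B' : Finset V} {D E : ℕ} (h : #B ≤ dg G a B + D)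
    (hB : B' ⊆ B) (_hE : #B ≤ #B' + E) : #B' ≤ dg G a B' + (D + E) := by
  have e1 := dg_sdiff (G := G) a hB
  have e2 := dg_le (G := G) a (B \ B')
  have e3 := card_sdiff_add_card_eq_card hB
  omega

/-- bipartite type structure -/
def Core1 (G : SimpleGraph V) (n : ℕ) (P Q : Finset V) : Prop :=
  Disjoint P Q ∧ (∀ p ∈ P, #Q ≤ dg G p Q + n / 10^6) ∧ (∀ q ∈ Q, #P ≤ dg G q P + n / 10^6) ∧
  n ≤ 2 * #P + 2 * (n / 10^6) ∧ n ≤ 2 * #Q + 2 * (n / 10^6)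

/-- extremal type structure -/
structure Core2 (G : SimpleGraph V) (n D : ℕ) (K P Q : Finset V) : Prop where
  dKP : Disjoint K P
  dKQ : Disjoint K Q
  dPQ : Disjoint P Q
  hK : ∀ p ∈ K, #K ≤ dg G p K + D
  hP : ∀ p ∈ P, #Q ≤ dg G p Q + D
  hQ : ∀ q ∈ Q, #P ≤ dg G q P + D
  lP : ∀ p ∈ P, dg G p K ≤ D
  lQ : ∀ p ∈ Q, dg G p K ≤ D
  cK : 2 * n ≤ 3 * #K + 3 * D
  cP : n ≤ 6 * #P + 6 * D
  cQ : n ≤ 6 * #Q + 6 * D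

theorem D1_sq (n : ℕ) (hn : 10^9 ≤ n) : (n : ℝ)^2 / 10^17 ≤ ((n / 10^8 : ℕ) : ℝ) * ((n / 10^8 : ℕ) : ℝ) := by
  have h1 : n < 10^8 * (n / 10^8) + 10^8 := by omega
  have h2 : (n : ℝ) < 10^8 * ((n / 10^8 : ℕ) : ℝ) + 10^8 := by exact_mod_cast h1
  have h3 : (10:ℝ)^9 ≤ n := by exact_mod_cast hn
  have h4 : 0.9 * (n : ℝ) / 10^8 ≤ ((n / 10^8 : ℕ) : ℝ) := by linarith
  have h5 : (0.9 * (n : ℝ) / 10^8) * (0.9 * (n : ℝ) / 10^8) ≤ ((n / 10^8 : ℕ) : ℝ) * ((n / 10^8 : ℕ) : ℝ) := by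
    gcongr
  nlinarith

theorem num_size (a b n s c δ : ℝ) (ha : 0 ≤ a) (hn : 0 < n) (h1 : a + b ≤ (2 * c + s) * n)
    (h2 : (c^2 - δ) * n^2 ≤ a * b) (hc : 0.1 ≤ c) (hc1 : c ≤ 1) (hs : s ≤ 10^(-18 : ℤ)) (hs0 : 0 ≤ s)
    (hδ : δ ≤ 10^(-18 : ℤ)) :
    (c - 10^(-8 : ℤ)) * n ≤ a := by
  norm_num at hs hδ ⊢
  by_contra! hlt
  obtain ⟨x, hx⟩ : ∃ x, x * n = a := ⟨a / n, by field_simp⟩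
  obtain ⟨y, hy⟩ : ∃ x, x * n = b := ⟨b / n, by field_simp⟩
  subst hx; subst hy
  have h3 : x + y ≤ 2 * c + s := le_of_mul_le_mul_right (by linarith) hn
  have h4 : c^2 - δ ≤ x * y := le_of_mul_le_mul_right (by linarith : _ * n^2 ≤ _ * n^2) (by positivity)
  have h5 : x < c - 1/100000000 := lt_of_mul_lt_mul_right hlt hn.le
  have h6 : 0 ≤ x := nonneg_of_mul_nonneg_left ha hn
  have h7 : x * y ≤ x * (2 * c + s - x) := by
    apply mul_le_mul_of_nonneg_left _ h6; linarith
  nlinarith [mul_nonneg (by linarith : 0 ≤ c - 1/100000000 - x) (by linarith : 0 ≤ c - 1/100000000 - x)]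

theorem core1_of {n : ℕ} (hn : 10^9 ≤ n) {G : SimpleGraph (Fin n)} {A B : Finset (Fin n)}
    (hd : Disjoint A B) (h : (1/4 - 51 * 10^(-22 : ℤ)) * (n : ℝ)^2 ≤ eo G A B) :
    ∃ P Q, Core1 G n P Q := by
  have hn' : (10:ℝ)^9 ≤ n := by exact_mod_cast hn
  have hab : (#A : ℝ) + #B ≤ n := by
    have := card_le_univ (A ∪ B)
    rw [card_union_of_disjoint hd, Fintype.card_fin] at this
    exact_mod_cast this
  have hD := D1_sq n hn
  set D1 := n / 10^8 with hD1
  have heo : (eo G A B : ℝ) ≤ #A * #B := by exact_mod_cast eo_le A B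
  have hdef : #A * #B ≤ eo G A B + D1 * D1 := by
    have : (#A * #B : ℝ) ≤ eo G A B + D1 * D1 := by
      have h1 : (#A * #B : ℝ) ≤ (n:ℝ)^2/4 := by
        nlinarith [sq_nonneg ((#A : ℝ) - #B), (Nat.cast_nonneg #A : (0:ℝ) ≤ #A), (Nat.cast_nonneg #B : (0:ℝ) ≤ #B)]
      norm_num at h
      linarith [sq_nonneg (n:ℝ)]
    exact_mod_cast this
  have hdef' : #B * #A ≤ eo G B A + D1 * D1 := by rw [mul_comm, eo_symm]; exact hdef
  have e1 := extract hdef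
  have e2 := extract hdef'
  have s1 : (1/2 - 10^(-8 : ℤ)) * (n:ℝ) ≤ #A := by
    refine num_size _ #B n 0 (1/2) (51 * 10^(-22 : ℤ)) (by positivity) (by linarith) (by linarith) ?_
      (by norm_num) (by norm_num) (by norm_num) (by norm_num) (by norm_num)
    refine le_trans (le_of_eq ?_) (h.trans heo)
    norm_num
  have s2 : (1/2 - 10^(-8 : ℤ)) * (n:ℝ) ≤ #B := by
    refine num_size _ #A n 0 (1/2) (51 * 10^(-22 : ℤ)) (by positivity) (by linarith) (by linarith) ?_
      (by norm_num) (by norm_num) (by norm_num) (by norm_num) (by norm_num)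
    rw [mul_comm (#B : ℝ)]
    refine le_trans (le_of_eq ?_) (h.trans heo)
    norm_num
  norm_num at s1 s2
  have s1' : 49999999 * n ≤ 100000000 * #A := by
    have : (49999999 * n : ℝ) ≤ 100000000 * #A := by linarith
    exact_mod_cast this
  have s2' : 49999999 * n ≤ 100000000 * #B := by
    have : (49999999 * n : ℝ) ≤ 100000000 * #B := by linarith
    exact_mod_cast this
  set P := A.filter fun a => #B ≤ dg G a B + D1 with hP
  set Q := B.filter fun a => #A ≤ dg G a A + D1 with hQ
  have hPA : P ⊆ A := filter_subset _ _
  have hQB : Q ⊆ B := filter_subset _ _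
  refine ⟨P, Q, hd.mono (filter_subset _ _) (filter_subset _ _), ?_, ?_, by omega, by omega⟩
  · intro p hp
    have := dg_shrink (mem_filter.1 hp).2 hQB e2
    omega
  · intro p hp
    have := dg_shrink (mem_filter.1 hp).2 hPA e1
    omega

theorem core2_of {n : ℕ} (hn : 10^10 ≤ n) {G : SimpleGraph (Fin n)} {T A B : Finset (Fin n)}
    (hG : (eo G univ univ : ℝ) ≤ (n:ℝ)^2/2 + 2)
    (hTd : Disjoint T (A ∪ B)) (hd : Disjoint A B)
    (h1 : (4/9 - 2000 * 10^(-22 : ℤ)) * (n : ℝ)^2 ≤ eo G T T)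
    (h2 : (#T : ℝ) ≤ (2/3 + 12 * 10^(-22 : ℤ)) * n)
    (h3 : (1/36 - 2000 * 10^(-22 : ℤ)) * (n : ℝ)^2 ≤ eo G A B)
    (h4 : (#A + #B : ℝ) ≤ (1/3 + 675 * 10^(-22 : ℤ)) * n) :
    ∃ K P Q, Core2 G n (n / 10^6) K P Q := by
  have hn' : (10:ℝ)^10 ≤ n := by exact_mod_cast hn
  have hD := D1_sq n (by omega)
  set D1 := n / 10^8 with hD1
  have heoAB : (eo G A B : ℝ) ≤ #A * #B := by exact_mod_cast eo_le A B
  have heoT : (eo G T T : ℝ) ≤ #T * #T := by exact_mod_cast eo_le T T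
  have hsq : (10:ℝ)^20 ≤ (n:ℝ)^2 := by nlinarith
  norm_num at h1 h2 h3 h4
  have hdT : #T * #T ≤ eo G T T + D1 * D1 := by
    have : (#T * #T : ℝ) ≤ eo G T T + D1 * D1 := by
      have : (#T * #T : ℝ) ≤ ((2/3 + 12 / 10^22) * n) * ((2/3 + 12 / 10^22) * n) := by
        gcongr <;> linarith
      linarith
    exact_mod_cast this
  have hdAB : #A * #B ≤ eo G A B + D1 * D1 := by
    have : (#A * #B : ℝ) ≤ eo G A B + D1 * D1 := by
      have h5 : (#A * #B : ℝ) ≤ (#A + #B) * (#A + #B) / 4 := by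
        nlinarith [sq_nonneg ((#A : ℝ) - #B)]
      have h6 : (#A + #B : ℝ) * (#A + #B) ≤ ((1/3 + 675 / 10^22) * n) * ((1/3 + 675 / 10^22) * n) := by
        gcongr <;> linarith
      linarith
    exact_mod_cast this
  have hdBA : #B * #A ≤ eo G B A + D1 * D1 := by rw [mul_comm, eo_symm]; exact hdAB
  have hlow : eo G (A ∪ B) T ≤ D1 * D1 := by
    have q1 : eo G T T + 2 * eo G T (A ∪ B) + eo G (A ∪ B) (A ∪ B) ≤ eo G univ univ := by
      rw [← eo_union_self hTd]; exact eo_mono (subset_univ _) (subset_univ _)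
    have q2 : 2 * eo G A B ≤ eo G (A ∪ B) (A ∪ B) := by
      rw [eo_union_self hd]; omega
    have q3 : (eo G T T : ℝ) + 2 * eo G T (A ∪ B) + 2 * eo G A B ≤ eo G univ univ := by
      exact_mod_cast (by omega : eo G T T + 2 * eo G T (A ∪ B) + 2 * eo G A B ≤ eo G univ univ)
    rw [eo_symm]
    have : (eo G T (A ∪ B) : ℝ) ≤ D1 * D1 := by linarith
    exact_mod_cast this
  have lA : eo G A T ≤ D1 * D1 := (eo_mono subset_union_left (Subset.refl _)).trans hlow
  have lB : eo G B T ≤ D1 * D1 := (eo_mono subset_union_right (Subset.refl _)).trans hlow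
  have e1 := extract hdT
  have e2 := extract hdAB
  have e3 := extract hdBA
  have e4 := low_deg lA
  have e5 := low_deg lB
  have s1 : (1/6 - 10^(-8 : ℤ)) * (n:ℝ) ≤ #A := by
    refine num_size _ #B n (675/10^22) (1/6) (2000 / 10^22) (by positivity) (by linarith) (by linarith) ?_
      (by norm_num) (by norm_num) (by norm_num) (by norm_num) (by norm_num)
    refine le_trans (le_of_eq ?_) (h3.trans heoAB)
    norm_num
  have s2 : (1/6 - 10^(-8 : ℤ)) * (n:ℝ) ≤ #B := by
    refine num_size _ #A n (675/10^22) (1/6) (2000 / 10^22) (by positivity) (by linarith) (by linarith) ?_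
      (by norm_num) (by norm_num) (by norm_num) (by norm_num) (by norm_num)
    rw [mul_comm (#B : ℝ)]
    refine le_trans (le_of_eq ?_) (h3.trans heoAB)
    norm_num
  have s3 : (2/3 - 10^(-8 : ℤ)) * (n:ℝ) ≤ #T := by
    refine num_size _ #T n (24/10^22) (2/3) (2000 / 10^22) (by positivity) (by linarith) (by linarith) ?_
      (by norm_num) (by norm_num) (by norm_num) (by norm_num) (by norm_num)
    refine le_trans (le_of_eq ?_) (h1.trans heoT)
    norm_num
  norm_num at s1 s2 s3
  have s1' : 49999997 * n ≤ 300000000 * #A := by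
    have : (49999997 * n : ℝ) ≤ 300000000 * #A := by linarith
    exact_mod_cast this
  have s2' : 49999997 * n ≤ 300000000 * #B := by
    have : (49999997 * n : ℝ) ≤ 300000000 * #B := by linarith
    exact_mod_cast this
  have s3' : 199999997 * n ≤ 300000000 * #T := by
    have : (199999997 * n : ℝ) ≤ 300000000 * #T := by linarith
    exact_mod_cast this
  set K := T.filter fun a => #T ≤ dg G a T + D1 with hK
  set P1 := A.filter fun a => #B ≤ dg G a B + D1 with hP1
  set Q1 := B.filter fun a => #A ≤ dg G a A + D1 with hQ1
  set P2 := A.filter fun a => dg G a T ≤ D1 with hP2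
  set Q2 := B.filter fun a => dg G a T ≤ D1 with hQ2
  have cP : #A ≤ #(P1 ∩ P2) + 2 * D1 := by
    have := card_union_add_card_inter P1 P2
    have : #(P1 ∪ P2) ≤ #A := card_le_card (union_subset (filter_subset _ _) (filter_subset _ _))
    omega
  have cQ : #B ≤ #(Q1 ∩ Q2) + 2 * D1 := by
    have := card_union_add_card_inter Q1 Q2
    have : #(Q1 ∪ Q2) ≤ #B := card_le_card (union_subset (filter_subset _ _) (filter_subset _ _))
    omega
  have hKT : K ⊆ T := filter_subset _ _
  have hPA : P1 ∩ P2 ⊆ A := inter_subset_left.trans (filter_subset _ _)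
  have hQB : Q1 ∩ Q2 ⊆ B := inter_subset_left.trans (filter_subset _ _)
  rw [disjoint_union_right] at hTd
  refine ⟨K, P1 ∩ P2, Q1 ∩ Q2, hTd.1.mono hKT hPA, hTd.2.mono hKT hQB, hd.mono hPA hQB, ?_, ?_, ?_,
    ?_, ?_, by omega, by omega, by omega⟩
  · intro p hp
    have := dg_shrink (mem_filter.1 hp).2 hKT e1
    omega
  · intro p hp
    have := dg_shrink (mem_filter.1 (mem_inter.1 hp).1).2 hQB cQ
    omega
  · intro p hp
    have := dg_shrink (mem_filter.1 (mem_inter.1 hp).1).2 hPA cP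
    omega
  · intro p hp
    have := (mem_filter.1 (mem_inter.1 hp).2).2
    have := dg_mono (G := G) p hKT
    omega
  · intro p hp
    have := (mem_filter.1 (mem_inter.1 hp).2).2
    have := dg_mono (G := G) p hKT
    omega

theorem structure_thm (k : ℕ) (hk : 3 ≤ k) : ∃ n0 : ℕ, ∀ n : ℕ, n0 ≤ n → ∀ G : SimpleGraph (Fin n),
    eo G univ univ = 2 * (n^2/4 + 1) →
    (1/18 - 10^(-22 : ℤ)) * (n : ℝ)^2 ≤ eo (Bl G k) univ univ →
    (∃ P Q, Core1 G n P Q) ∨ (∃ K P Q, Core2 G n (n / 10^6) K P Q) := by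
  obtain ⟨n0, h0⟩ := lemmaA k hk (10^(-22 : ℤ)) (by norm_num)
  refine ⟨n0 + 10^10, fun n hn G hG hB => ?_⟩
  obtain ⟨H, hH, hrem, hred⟩ := h0 n (by omega) G
  have hn1 : 10^10 ≤ n := by omega
  have hn' : (10:ℝ)^10 ≤ n := by exact_mod_cast hn1
  set rem := (univ : Finset (Fin n × Fin n)).filter fun p => G.Adj p.1 p.2 ∧ ¬ H.Adj p.1 p.2 with hremdef
  set T : Finset (Fin n) := univ.filter fun t => ∃ x y, H.Adj t x ∧ H.Adj x y ∧ H.Adj y t with hT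
  set W : Finset (Fin n) := univ.filter fun w => w ∉ T ∧ ∀ t ∈ T, ¬ H.Adj w t with hW
  have hGup : (eo G univ univ : ℝ) ≤ (n:ℝ)^2/2 + 2 := by
    have : 2 * eo G univ univ ≤ n^2 + 4 := by omega
    have : (2 * eo G univ univ : ℝ) ≤ (n:ℝ)^2 + 4 := by exact_mod_cast this
    linarith
  have hGlo : (n:ℝ)^2/2 ≤ eo G univ univ := by
    have : n^2 ≤ 2 * eo G univ univ := by omega
    have : (n:ℝ)^2 ≤ 2 * eo G univ univ := by exact_mod_cast this
    linarith
  have c1 : eo G univ univ ≤ #rem + eo H univ univ := by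
    rw [eo_eq_card, eo_eq_card]
    refine le_trans (card_le_card ?_) (card_union_le _ _)
    rintro ⟨a, b⟩ hab
    simp only [mem_filter, mem_product, mem_univ, true_and, mem_union, hremdef] at hab ⊢
    tauto
  have c2 : eo (Bl G k) univ univ ≤ #rem + eo H W W := by
    rw [eo_eq_card, eo_eq_card]
    refine le_trans (card_le_card ?_) (card_union_le _ _)
    rintro ⟨a, b⟩ hab
    simp only [mem_filter, mem_product, mem_univ, true_and, mem_union, hremdef] at hab ⊢
    by_cases hHab : H.Adj a b
    · right
      have key : ∀ a b, H.Adj a b → (Bl G k).Adj a b → a ∈ W := by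
        intro a b hab hbl
        rw [hW, mem_filter]
        refine ⟨mem_univ _, ?_, ?_⟩
        · intro haT
          rw [hT, mem_filter] at haT
          obtain ⟨-, x, y, h1, h2, h3⟩ := haT
          exact hbl.2 (hred a b a x y hab (Or.inl rfl) h1 h2 h3)
        · intro t ht hat
          rw [hT, mem_filter] at ht
          obtain ⟨-, x, y, h1, h2, h3⟩ := ht
          exact hbl.2 (hred a b t x y hab (Or.inr hat) h1 h2 h3)
      exact ⟨⟨key a b hHab hab, key b a hHab.symm hab.symm⟩, hHab⟩
    · left; exact ⟨hab.1, hHab⟩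
  have c1' : (eo G univ univ : ℝ) ≤ #rem + eo H univ univ := by exact_mod_cast c1
  have c2' : (eo (Bl G k) univ univ : ℝ) ≤ #rem + eo H W W := by exact_mod_cast c2
  have a1 : ((1:ℝ)/2 - 10^(-22 : ℤ)) * (n:ℝ)^2 ≤ eo H univ univ := by
    generalize (10:ℝ)^(-22:ℤ) = η at *
    nlinarith
  have a2 : ((1:ℝ)/18 - 2 * 10^(-22 : ℤ)) * (n:ℝ)^2 ≤ eo H W W := by
    generalize (10:ℝ)^(-22:ℤ) = η at *
    nlinarith
  have := lemmaC H (10^(-22 : ℤ)) (by norm_num) (by norm_num) (by rw [Fintype.card_fin]; omega) T W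
    (by intro t; simp [hT]) (by intro w; simp [hW]) (by rw [Fintype.card_fin]; exact a1)
    (by rw [Fintype.card_fin]; exact a2)
  rw [Fintype.card_fin] at this
  rcases this with ⟨A, B, hd, h⟩ | ⟨T', A, B, hd1, hd2, h1, h2, h3, h4⟩
  · left
    exact core1_of (by omega) hd (h.trans (by exact_mod_cast eo_mono_graph hH A B))
  · right
    exact core2_of (by omega) hGup hd1 hd2 (h1.trans (by exact_mod_cast eo_mono_graph hH _ _)) h2
      (h3.trans (by exact_mod_cast eo_mono_graph hH _ _)) h4

end cores

section caseone
open Finset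

theorem blue_drop {V : Type*} [Fintype V] [DecidableEq V] {G : SimpleGraph V} {k : ℕ}
    (S : Finset (V × V)) (hS : ∀ p ∈ S, ¬ (Bl G k).Adj p.1 p.2) :
    eo (Bl G k) univ univ + #(S.filter fun p => G.Adj p.1 p.2) ≤ eo G univ univ := by
  rw [eo_eq_card, eo_eq_card, ← card_union_of_disjoint]
  · refine card_le_card (union_subset ?_ ?_)
    · intro p hp
      simp only [mem_filter, mem_product, mem_univ, true_and] at hp ⊢
      exact hp.1
    · intro p hp
      simp only [mem_filter, mem_product, mem_univ, true_and] at hp ⊢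
      exact hp.2
  · rw [Finset.disjoint_left]
    intro p hp hp'
    simp only [mem_filter, mem_product, mem_univ, true_and] at hp hp'
    exact hS p hp'.1 hp

theorem eo_ge_of_dg {V : Type*} {G : SimpleGraph V} {A B : Finset V} {D : ℕ}
    (h : ∀ a ∈ A, #B ≤ dg G a B + D) : #A * #B ≤ eo G A B + #A * D := by
  unfold eo
  rw [← smul_eq_mul, ← sum_const, ← smul_eq_mul (a := #A), ← sum_const, ← sum_add_distrib]
  exact sum_le_sum h

theorem eo_split {V : Type*} [Fintype V] [DecidableEq V] {G : SimpleGraph V} (A L : Finset V)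
    (hd : Disjoint A L) (hu : A ∪ L = univ) :
    eo G univ univ ≤ eo G A A + 2 * eo G L univ := by
  rw [← hu, eo_union_self hd, eo_union_right L hd, eo_symm L A]
  omega

theorem num_d1 (n D a b e bl g : ℕ) (hn : 10^9 ≤ n) (hD : D = n / 10^6) (ha : n ≤ 2 * a + 2 * D + n / 100)
    (hb : n ≤ 2 * b + 2 * D + n / 100) (h1 : a * b ≤ g + a * D) (h2 : bl + (g + g) ≤ e)
    (he : 2 * e ≤ n^2 + 4) (hbl : n^2 ≤ 20 * bl) (hab : a + b ≤ n) : False := by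
  have ha' : 49 * n ≤ 100 * a := by omega
  have hb' : 49 * n ≤ 100 * b := by omega
  have hD' : 1000 * D ≤ n := by omega
  have h3 : (49 * n) * (49 * n) ≤ (100 * a) * (100 * b) := Nat.mul_le_mul ha' hb'
  have h4 : a * (1000 * D) ≤ n * n := Nat.mul_le_mul (by omega) hD'
  nlinarith

theorem blue1 {n k : ℕ} {G : SimpleGraph (Fin n)} {P Q : Finset (Fin n)} (hn : 10^9 ≤ n)
    (h : Core1 G n P Q) (he : 2 * eo G univ univ ≤ n^2 + 4)
    (hbl : n^2 ≤ 20 * eo (Bl G k) univ univ) (P0 Q0 : Finset (Fin n)) (hP : P0 ⊆ P) (hQ : Q0 ⊆ Q)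
    (cP : #P ≤ #P0 + n / 200) (cQ : #Q ≤ #Q0 + n / 200) : ∃ p ∈ P0, ∃ q ∈ Q0, (Bl G k).Adj p q := by
  by_contra! hno
  obtain ⟨h1, h2, h3, h4, h5⟩ := h
  have hdis : Disjoint P0 Q0 := h1.mono hP hQ
  have hB := blue_drop (G := G) (k := k) (P0 ×ˢ Q0 ∪ Q0 ×ˢ P0) (by
    rintro ⟨p, q⟩ hpq
    simp only [mem_union, mem_product] at hpq
    rcases hpq with hpq | hpq
    · exact hno p hpq.1 q hpq.2
    · exact fun hh => hno q hpq.2 p hpq.1 hh.symm)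
  rw [filter_union, card_union_of_disjoint, ← eo_eq_card, ← eo_eq_card, eo_symm Q0 P0] at hB
  · have h6 : ∀ p ∈ P0, #Q0 ≤ dg G p Q0 + (n / 10^6 + n / 200) := fun p hp => dg_shrink (h2 p (hP hp)) hQ cQ
    have e1 : #P0 * #Q0 ≤ eo G P0 Q0 + #P0 * (n / 10^6) := by
      apply eo_ge_of_dg
      intro p hp
      have := dg_sdiff (G := G) p hQ
      have := dg_le (G := G) p (Q \ Q0)
      have := h2 p (hP hp)
      have := card_sdiff_add_card_eq_card hQ
      omega
    have : #P0 + #Q0 ≤ n := by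
      rw [← card_union_of_disjoint hdis]
      simpa using card_le_univ (P0 ∪ Q0)
    exact num_d1 n _ #P0 #Q0 _ _ _ hn rfl (by omega) (by omega) e1 hB he hbl this
  · rw [Finset.disjoint_left]
    rintro ⟨p, q⟩ hp hp'
    simp only [mem_filter, mem_product] at hp hp'
    exact Finset.disjoint_left.1 hdis hp.1.1 hp'.1.1

theorem num_f (n l a b : ℕ) (h : a + b + l = n) (d e : ℕ) (hd : 8 * d ≤ n) (he : e ≤ 2 * (a * b) + 2 * (l * d)) :
    e ≤ 2 * (n^2/4) := by
  have h1 : 4 * (a * b) ≤ (a + b) * (a + b) := by zify; nlinarith [sq_nonneg ((a:ℤ) - b)]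
  have h2 : l * (8 * d) ≤ l * n := Nat.mul_le_mul_left _ hd
  have h3 : 4 * (a * b + l * d) ≤ n^2 := by
    subst h; nlinarith
  have : a * b + l * d ≤ n^2 / 4 := by omega
  omega

theorem case1 {n k : ℕ} {G : SimpleGraph (Fin n)} {P Q : Finset (Fin n)} (hk : 3 ≤ k)
    (hn : 10^9 * k ≤ n) (h : Core1 G n P Q) (he : eo G univ univ = 2 * (n^2/4 + 1))
    (hbl : n^2 ≤ 20 * eo (Bl G k) univ univ) : False := by
  have hB := blue1 (k := k) (by omega) h (by omega) hbl
  obtain ⟨h1, h2, h3, h4, h5⟩ := h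
  set D := n / 10^6 with hD
  have hc : Core G D (2 * k + 10) P Q := ⟨h1, h2, h3, by omega, by omega⟩
  set c := 2 * k + 10 with hcdef
  have hF : ∀ F : Finset (Fin n), #F ≤ 2 → ∃ p ∈ P, ∃ q ∈ Q, p ∉ F ∧ q ∉ F ∧ (Bl G k).Adj p q := by
    intro F hF
    obtain ⟨p, hp, q, hq, hpq⟩ := hB (P \ F) (Q \ F) sdiff_subset sdiff_subset
      (by have := le_card_sdiff F P; omega) (by have := le_card_sdiff F Q; omega)
    rw [mem_sdiff] at hp hq
    exact ⟨p, hp.1, q, hq.1, hp.2, hq.2, hpq⟩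
  have cI : ∀ v v', G.Adj v v' → D + c < dg G v Q → D + c < dg G v' Q → False := by
    intro v v' hvv hv hv'
    obtain ⟨p, hp, q, hq, hpF, hqF, hb⟩ := hF {v, v'} card_le_two
    simp only [mem_insert, mem_singleton, not_or] at hpF hqF
    exact hb.2 (claimI hc hk le_rfl hvv hv hv' hp hq hb.1 hpF.1 hpF.2 hqF.1 hqF.2)
  have cI' : ∀ v v', G.Adj v v' → D + c < dg G v P → D + c < dg G v' P → False := by
    intro v v' hvv hv hv'
    obtain ⟨p, hp, q, hq, hpF, hqF, hb⟩ := hF {v, v'} card_le_two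
    simp only [mem_insert, mem_singleton, not_or] at hpF hqF
    exact hb.symm.2 (claimI hc.symm hk le_rfl hvv hv hv' hq hp hb.1.symm hqF.1 hqF.2 hpF.1 hpF.2)
  have cII : ∀ v, D + c < dg G v Q → D + c < dg G v P → False := by
    intro v hv hv'
    obtain ⟨p, hp, q, hq, hpF, hqF, hb⟩ := hF {v} (by simp)
    simp only [mem_singleton] at hpF hqF
    exact hb.2 (claimII hc hk le_rfl hv hv' hp hq hb.1 hpF hqF)
  set P' : Finset (Fin n) := univ.filter fun v => D + c < dg G v Q with hP'
  set Q' : Finset (Fin n) := univ.filter fun v => D + c < dg G v P with hQ'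
  have hdis : Disjoint P' Q' := by
    rw [Finset.disjoint_left]
    intro v hv hv'
    exact cII v (mem_filter.1 hv).2 (mem_filter.1 hv').2
  set L := univ \ (P' ∪ Q') with hL
  have hs := eo_split (G := G) (P' ∪ Q') L disjoint_sdiff (union_sdiff_of_subset (subset_univ _))
  have e1 : eo G (P' ∪ Q') (P' ∪ Q') ≤ 2 * (#P' * #Q') := by
    rw [eo_union_self hdis]
    have a1 : eo G P' P' = 0 := eo_eq_zero fun a ha b hb hab => cI a b hab (mem_filter.1 ha).2 (mem_filter.1 hb).2
    have a2 : eo G Q' Q' = 0 := eo_eq_zero fun a ha b hb hab => cI' a b hab (mem_filter.1 ha).2 (mem_filter.1 hb).2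
    have := eo_le (G := G) P' Q'
    omega
  have e2 : eo G L univ ≤ #L * (4 * D + 2 * c) := by
    apply eo_le_of_dg
    intro v hv
    have hv' := (mem_sdiff.1 hv).2
    simp only [hP', hQ', mem_union, mem_filter, mem_univ, true_and, not_or, not_lt] at hv'
    have e3 := dg_sdiff (G := G) v (subset_univ (P ∪ Q))
    have e4 := dg_union (G := G) v h1
    have e5 := dg_le (G := G) v (univ \ (P ∪ Q))
    have e6 := card_sdiff_add_card_eq_card (subset_univ (P ∪ Q))
    rw [card_union_of_disjoint h1, card_univ, Fintype.card_fin] at e6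
    omega
  have hcard : #P' + #Q' + #L = n := by
    have e6 := card_sdiff_add_card_eq_card (subset_univ (P' ∪ Q'))
    rw [card_union_of_disjoint hdis, card_univ, Fintype.card_fin] at e6
    rw [hL]; omega
  have := num_f n #L #P' #Q' hcard (4 * D + 2 * c) (eo G univ univ) (by omega) (by linarith)
  omega

theorem num_d2 (n D a b κ e bl g gk : ℕ) (hn : 10^9 ≤ n) (hD : D = n / 10^6)
    (hκ : 2 * n ≤ 3 * κ + 3 * D)
    (ha : n ≤ 6 * a + 6 * D + 6 * (n / 200))
    (hb : n ≤ 6 * b + 6 * D + 6 * (n / 200)) (h1 : a * b ≤ g + a * D) (hk : κ * κ ≤ gk + κ * D)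
    (h2 : bl + (gk + (g + g)) ≤ e)
    (he : 2 * e ≤ n^2 + 4) (hbl : n^2 ≤ 20 * bl) (hab : a + b + κ ≤ n) : False := by
  have ha' : 161 * n ≤ 1000 * a := by omega
  have hb' : 161 * n ≤ 1000 * b := by omega
  have hκ' : 666 * n ≤ 1000 * κ := by omega
  have hD' : 1000 * D ≤ n := by omega
  have h3 : (161 * n) * (161 * n) ≤ (1000 * a) * (1000 * b) := Nat.mul_le_mul ha' hb'
  have h3 : (666 * n) * (666 * n) ≤ (1000 * κ) * (1000 * κ) := Nat.mul_le_mul hκ' hκ'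
  have h4 : a * (1000 * D) ≤ n * n := Nat.mul_le_mul (by omega) hD'
  have h4 : κ * (1000 * D) ≤ n * n := Nat.mul_le_mul (by omega) hD'
  nlinarith

theorem blue2 {n k : ℕ} {G : SimpleGraph (Fin n)} {K P Q : Finset (Fin n)} (hk : 3 ≤ k) (hn : 10^9 * k ≤ n)
    (h : Core2 G n (n / 10^6) K P Q) (he : 2 * eo G univ univ ≤ n^2 + 4)
    (hbl : n^2 ≤ 20 * eo (Bl G k) univ univ) (P0 Q0 : Finset (Fin n)) (hP : P0 ⊆ P) (hQ : Q0 ⊆ Q)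
    (cP : #P ≤ #P0 + n / 200) (cQ : #Q ≤ #Q0 + n / 200) : ∃ p ∈ P0, ∃ q ∈ Q0, (Bl G k).Adj p q := by
  by_contra! hno
  have hdis : Disjoint P0 Q0 := h.dPQ.mono hP hQ
  have dKP : Disjoint K P0 := h.dKP.mono_right hP
  have dKQ : Disjoint K Q0 := h.dKQ.mono_right hQ
  have g1 := h.cK
  have g2 := h.cP
  have g3 := h.cQ
  have hB := blue_drop (G := G) (k := k) (K ×ˢ K ∪ (P0 ×ˢ Q0 ∪ Q0 ×ˢ P0)) (by
    rintro ⟨p, q⟩ hpq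
    simp only [mem_union, mem_product] at hpq
    rcases hpq with hpq | hpq | hpq
    · intro hb
      have h1 := h.hK p hpq.1
      have h2 := h.hK q hpq.2
      exact hb.2 (Z_red (x := p) (y := q) (c := 2 * k + 10) h.hK (by omega) hk le_rfl (by omega) (by omega) hb.1)
    · exact hno p hpq.1 q hpq.2
    · exact fun hh => hno q hpq.2 p hpq.1 hh.symm)
  rw [filter_union, card_union_of_disjoint, filter_union, card_union_of_disjoint,
    ← eo_eq_card, ← eo_eq_card, ← eo_eq_card, eo_symm Q0 P0] at hB
  · have e1 : #P0 * #Q0 ≤ eo G P0 Q0 + #P0 * (n / 10^6) := by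
      apply eo_ge_of_dg
      intro p hp
      have := dg_sdiff (G := G) p hQ
      have := dg_le (G := G) p (Q \ Q0)
      have := h.hP p (hP hp)
      have := card_sdiff_add_card_eq_card hQ
      omega
    have e2 : #K * #K ≤ eo G K K + #K * (n / 10^6) := eo_ge_of_dg h.hK
    have : #P0 + #Q0 + #K ≤ n := by
      rw [← card_union_of_disjoint hdis, ← card_union_of_disjoint]
      · simpa using card_le_univ (P0 ∪ Q0 ∪ K)
      · rw [disjoint_union_left]; exact ⟨dKP.symm, dKQ.symm⟩
    exact num_d2 n _ #P0 #Q0 #K _ _ _ _ (by omega) rfl g1 (by omega) (by omega) e1 e2 hB he hbl this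
  · rw [Finset.disjoint_left]
    rintro ⟨p, q⟩ hp hp'
    simp only [mem_filter, mem_product] at hp hp'
    exact Finset.disjoint_left.1 hdis hp.1.1 hp'.1.1
  · rw [Finset.disjoint_left]
    rintro ⟨p, q⟩ hp hp'
    simp only [mem_filter, mem_product, mem_union] at hp hp'
    rcases hp'.1 with hp' | hp'
    · exact Finset.disjoint_left.1 dKP hp.1.1 hp'.1
    · exact Finset.disjoint_left.1 dKQ hp.1.1 hp'.1

end caseone

section casetwo
open Finset

/-- exact structure of near extremal graphs -/
structure St {n : ℕ} (G : SimpleGraph (Fin n)) (k D R : ℕ) (K Z P Q L : Finset (Fin n)) : Prop where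
  dZP : Disjoint Z P
  dZQ : Disjoint Z Q
  dPQ : Disjoint P Q
  dL : Disjoint (Z ∪ P ∪ Q) L
  un : (Z ∪ P ∪ Q) ∪ L = univ
  KZ : K ⊆ Z
  indP : ∀ v ∈ P, ∀ w ∈ P, ¬ G.Adj v w
  indQ : ∀ v ∈ Q, ∀ w ∈ Q, ¬ G.Adj v w
  mP : ∀ v ∈ P, dg G v Z ≤ 2 * R
  mQ : ∀ v ∈ Q, dg G v Z ≤ 2 * R
  degL : ∀ v ∈ L, 6 * dg G v univ + 6 * R ≤ n
  nP : ∀ v ∈ P, n ≤ 6 * dg G v Q + 24 * R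
  nQ : ∀ v ∈ Q, n ≤ 6 * dg G v P + 24 * R
  c3 : ∀ a ∈ Z, ∀ v ∈ P, ∀ w ∈ Q, G.Adj v a → ¬ G.Adj w a
  c4a : ∀ a ∈ Z, ∀ b ∈ Z, a ≠ b → ∀ v ∈ P, ∀ w ∈ Q, G.Adj v a → G.Adj w b → ∀ z ∈ K,
    G.Adj a z → ¬ G.Adj b z
  c4b : ∀ a ∈ Z, ∀ b ∈ Z, a ≠ b → ∀ v ∈ P, ∀ w ∈ Q, G.Adj v a → G.Adj w b → ¬ (Bl G k).Adj v w
  c5P : ∀ a ∈ Z, ∀ b ∈ Z, a ≠ b → ∀ v ∈ P, ∀ w ∈ P, v ≠ w → G.Adj v a → G.Adj w b → ∀ q ∈ Q,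
    G.Adj w q → ¬ (Bl G k).Adj v q
  c5Q : ∀ a ∈ Z, ∀ b ∈ Z, a ≠ b → ∀ v ∈ Q, ∀ w ∈ Q, v ≠ w → G.Adj v a → G.Adj w b → ∀ q ∈ P,
    G.Adj w q → ¬ (Bl G k).Adj v q
  redZ : ∀ a ∈ Z, ∀ b ∈ Z, ¬ (Bl G k).Adj a b
  sK : 2 * n ≤ 3 * #K + 3 * D
  sZ : 3 * #Z ≤ 2 * n + 15 * D
  sP : 6 * #P ≤ n + 30 * D
  sQ : 6 * #Q ≤ n + 30 * D
  lP : n ≤ 6 * #P + 6 * D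
  lQ : n ≤ 6 * #Q + 6 * D
  sL : #L ≤ 3 * D

theorem dg_minus {V : Type*} [DecidableEq V] {G : SimpleGraph V} (v : V) (S : Finset V) (x : V) :
    dg G v S ≤ #((S.filter (G.Adj v)) \ {x}) + 1 := by
  have := le_card_sdiff {x} (S.filter (G.Adj v))
  rw [card_singleton] at this
  unfold dg
  omega

theorem num_nbr {n k D R a d y : ℕ} (hn : 10^9 * k ≤ n) (hk : 3 ≤ k) (hD : D = n / 10^6)
    (hR : R = n / 1000) (h1 : n ≤ 6 * d + 24 * R) (h2 : 6 * a ≤ n + 30 * D) (h3 : d ≤ y + 1) :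
    a ≤ y + n / 200 := by
  omega

theorem num_degL {n k D R c a q p d : ℕ} (hn : 10^9 * k ≤ n) (hk : 3 ≤ k) (hD : D = n / 10^6)
    (hR : R = n / 1000) (hc : c = 2 * k + 10) (h1 : a < R) (h2 : 6 * q + 24 * R < n) (h3 : p ≤ D + c)
    (h4 : d ≤ a + p + q + 3 * D) : 6 * d + 6 * R ≤ n := by
  omega

set_option maxHeartbeats 2000000 in
theorem struct2 {n k : ℕ} {G : SimpleGraph (Fin n)} {K P Q : Finset (Fin n)} (hk : 3 ≤ k)
    (hn : 10^9 * k ≤ n) (h : Core2 G n (n / 10^6) K P Q) (he : 2 * eo G univ univ ≤ n^2 + 4)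
    (hbl : n^2 ≤ 20 * eo (Bl G k) univ univ) (D R : ℕ) (hD : D = n / 10^6) (hR : R = n / 1000) :
    ∃ Z P' Q' L, St G k D R K Z P' Q' L := by
  have hB := blue2 (k := k) hk hn h he hbl
  obtain ⟨dKP, dKQ, dPQ, hK, hP, hQ, lP, lQ, cK, cP, cQ⟩ := h
  rw [← hD] at hK hP hQ lP lQ cK cP cQ
  clear he hbl
  have hc : Core G D (2 * k + 10) P Q := ⟨dPQ, hP, hQ, by omega, by omega⟩
  obtain ⟨c, hcdef⟩ : ∃ D, D = 2 * k + 10 := ⟨_, rfl⟩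
  rw [← hcdef] at hc
  have hcle : 2 * k + 10 ≤ c := hcdef.ge
  have hcK : D + c < #K := by omega
  have hcR : D + c < R := by omega
  have hF : ∀ F : Finset (Fin n), #F ≤ 2 → ∃ p ∈ P, ∃ q ∈ Q, p ∉ F ∧ q ∉ F ∧ (Bl G k).Adj p q := by
    intro F hF
    obtain ⟨p, hp, q, hq, hpq⟩ := hB (P \ F) (Q \ F) sdiff_subset sdiff_subset
      (by have := le_card_sdiff F P; omega) (by have := le_card_sdiff F Q; omega)
    rw [mem_sdiff] at hp hq
    exact ⟨p, hp.1, q, hq.1, hp.2, hq.2, hpq⟩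
  have cI : ∀ v v', G.Adj v v' → D + c < dg G v Q → D + c < dg G v' Q → False := by
    intro v v' hvv hv hv'
    obtain ⟨p, hp, q, hq, hpF, hqF, hb⟩ := hF {v, v'} card_le_two
    simp only [mem_insert, mem_singleton, not_or] at hpF hqF
    exact hb.2 (claimI hc hk hcle hvv hv hv' hp hq hb.1 hpF.1 hpF.2 hqF.1 hqF.2)
  have cI' : ∀ v v', G.Adj v v' → D + c < dg G v P → D + c < dg G v' P → False := by
    intro v v' hvv hv hv'
    obtain ⟨p, hp, q, hq, hpF, hqF, hb⟩ := hF {v, v'} card_le_two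
    simp only [mem_insert, mem_singleton, not_or] at hpF hqF
    exact hb.symm.2 (claimI hc.symm hk hcle hvv hv hv' hq hp hb.1.symm hqF.1 hqF.2 hpF.1 hpF.2)
  have cII : ∀ v, D + c < dg G v Q → D + c < dg G v P → False := by
    intro v hv hv'
    obtain ⟨p, hp, q, hq, hpF, hqF, hb⟩ := hF {v} (by simp)
    simp only [mem_singleton] at hpF hqF
    exact hb.2 (claimII hc hk hcle hv hv' hp hq hb.1 hpF hqF)
  obtain ⟨O, hO⟩ : ∃ O : Finset (Fin n), O = univ \ (K ∪ P ∪ Q) := ⟨_, rfl⟩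
  have dKPQ : Disjoint (K ∪ P) Q := by rw [disjoint_union_left]; exact ⟨dKQ, dPQ⟩
  have cO : #O + (#K + #P + #Q) = n := by
    have e6 := card_sdiff_add_card_eq_card (subset_univ (K ∪ P ∪ Q))
    rw [card_union_of_disjoint dKPQ, card_union_of_disjoint dKP, card_univ, Fintype.card_fin, ← hO] at e6
    exact e6
  have hdeg : ∀ v, dg G v univ ≤ dg G v K + dg G v P + dg G v Q + 3 * D := by
    intro v
    have e3 := dg_sdiff (G := G) v (subset_univ (K ∪ P ∪ Q))
    have e4 := dg_union (G := G) v dKPQ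
    have e4' := dg_union (G := G) v dKP
    have e5 := dg_le (G := G) v O
    rw [← hO] at e3
    omega
  obtain ⟨Z, mZ⟩ : ∃ Z : Finset (Fin n), ∀ v, v ∈ Z ↔ R ≤ dg G v K :=
    ⟨univ.filter fun v => R ≤ dg G v K, fun v => by simp⟩
  obtain ⟨P', mP⟩ : ∃ P' : Finset (Fin n), ∀ v, v ∈ P' ↔ v ∉ Z ∧ n ≤ 6 * dg G v Q + 24 * R :=
    ⟨univ.filter fun v => v ∉ Z ∧ n ≤ 6 * dg G v Q + 24 * R, fun v => by simp⟩
  obtain ⟨Q', mQ⟩ : ∃ P' : Finset (Fin n), ∀ v, v ∈ P' ↔ v ∉ Z ∧ n ≤ 6 * dg G v P + 24 * R :=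
    ⟨univ.filter fun v => v ∉ Z ∧ n ≤ 6 * dg G v P + 24 * R, fun v => by simp⟩
  have KZ : K ⊆ Z := by
    intro v hv
    have := hK v hv
    rw [mZ]; omega
  have PP : P ⊆ P' := by
    intro v hv
    have := hP v hv
    have := lP v hv
    rw [mP, mZ]; omega
  have QQ : Q ⊆ Q' := by
    intro v hv
    have := hQ v hv
    have := lQ v hv
    rw [mQ, mZ]; omega
  have rZ : ∀ v ∈ Z, D + c < dg G v K := by
    intro v hv; rw [mZ] at hv; omega
  have rP : ∀ v ∈ P', D + c < dg G v Q := by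
    intro v hv; rw [mP] at hv; omega
  have rQ : ∀ v ∈ Q', D + c < dg G v P := by
    intro v hv; rw [mQ] at hv; omega
  have dZP : Disjoint Z P' := by
    rw [Finset.disjoint_left]; intro v hv hv'; exact ((mP v).1 hv').1 hv
  have dZQ : Disjoint Z Q' := by
    rw [Finset.disjoint_left]; intro v hv hv'; exact ((mQ v).1 hv').1 hv
  have dPQ' : Disjoint P' Q' := by
    rw [Finset.disjoint_left]; intro v hv hv'; exact cII v (rP v hv) (rQ v hv')
  have nZP : ∀ a ∈ Z, ∀ b ∈ P', a ≠ b := by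
    rintro a ha b hb rfl; exact Finset.disjoint_left.1 dZP ha hb
  have nZQ : ∀ a ∈ Z, ∀ b ∈ Q', a ≠ b := by
    rintro a ha b hb rfl; exact Finset.disjoint_left.1 dZQ ha hb
  have nPQ : ∀ a ∈ P', ∀ b ∈ Q', a ≠ b := by
    rintro a ha b hb rfl; exact Finset.disjoint_left.1 dPQ' ha hb
  have nbr : ∀ (v : Fin n) (S : Finset (Fin n)) (x : Fin n), n ≤ 6 * dg G v S + 24 * R → 6 * #S ≤ n + 30 * D →
      #S ≤ #((S.filter (G.Adj v)) \ {x}) + n / 200 := by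
    intro v S x h1 h2
    have h3 := dg_minus (G := G) v S x
    exact num_nbr hn hk hD hR h1 h2 h3
  have sub : ∀ S S' : Finset (Fin n), S ⊆ S' → (∀ v ∈ S', v ∉ S → v ∈ O) → #S' ≤ #S + 3 * D := by
    intro S S' h1 h2
    have h3 : #(S' \ S) ≤ #O := card_le_card fun v hv => by
      rw [mem_sdiff] at hv; exact h2 v hv.1 hv.2
    have h4 := card_sdiff_add_card_eq_card h1
    have h5 : #O ≤ 3 * D := by omega
    clear cO cK cP cQ
    omega
  have mO : ∀ v, v ∈ O ↔ v ∉ K ∧ v ∉ P ∧ v ∉ Q := by intro v; simp [hO]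
  have sZ : #Z ≤ #K + 3 * D := sub _ _ KZ fun v hv hv' => by
    rw [mO]; exact ⟨hv', fun hh => nZP v hv v (PP hh) rfl, fun hh => nZQ v hv v (QQ hh) rfl⟩
  have sP : #P' ≤ #P + 3 * D := sub _ _ PP fun v hv hv' => by
    rw [mO]; exact ⟨fun hh => nZP v (KZ hh) v hv rfl, hv', fun hh => nPQ v hv v (QQ hh) rfl⟩
  have sQ : #Q' ≤ #Q + 3 * D := sub _ _ QQ fun v hv hv' => by
    rw [mO]; exact ⟨fun hh => nZQ v (KZ hh) v hv rfl, fun hh => nPQ v (PP hh) v hv rfl, hv'⟩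
  have uP : 6 * #P ≤ n + 30 * D := by omega
  have uQ : 6 * #Q ≤ n + 30 * D := by omega
  have dgZ : ∀ v, v ∉ Z → dg G v Z ≤ 2 * R := by
    intro v hv
    rw [mZ] at hv
    have := dg_sdiff (G := G) v KZ
    have := dg_le (G := G) v (Z \ K)
    have := card_sdiff_add_card_eq_card KZ
    omega
  refine ⟨Z, P', Q', univ \ (Z ∪ P' ∪ Q'), dZP, dZQ, dPQ', disjoint_sdiff,
    union_sdiff_of_subset (subset_univ _), KZ, ?_, ?_, ?_, ?_, ?_, ?_, ?_, ?_, ?_, ?_, ?_, ?_, ?_,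
    cK, by omega, by omega, by omega, ?_, ?_, ?_⟩
  · exact fun v hv w hw hvw => cI v w hvw (rP v hv) (rP w hw)
  · exact fun v hv w hw hvw => cI' v w hvw (rQ v hv) (rQ w hw)
  · exact fun v hv => dgZ v ((mP v).1 hv).1
  · exact fun v hv => dgZ v ((mQ v).1 hv).1
  · intro v hv
    simp only [mem_sdiff, mem_univ, true_and, mem_union, not_or, mP, mQ] at hv
    have h1 : ¬ R ≤ dg G v K := by rw [← mZ]; exact hv.1.1
    have h2 : ¬ n ≤ 6 * dg G v Q + 24 * R := fun hh => hv.1.2 ⟨hv.1.1, hh⟩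
    have h3 : ¬ n ≤ 6 * dg G v P + 24 * R := fun hh => hv.2 ⟨hv.1.1, hh⟩
    have h4 := cII v
    have h5 := hdeg v
    rw [not_le] at h1 h2 h3
    by_cases h6 : D + c < dg G v Q
    · have h7 := not_lt.1 (h4 h6)
      exact num_degL hn hk hD hR hcdef h1 h2 h7 (by linarith)
    · exact num_degL hn hk hD hR hcdef h1 h3 (not_lt.1 h6) (by linarith)
  · intro v hv
    have h1 := ((mP v).1 hv).2
    have h2 := dg_mono (G := G) v QQ
    linarith
  · intro v hv
    have h1 := ((mQ v).1 hv).2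
    have h2 := dg_mono (G := G) v PP
    linarith
  · intro a ha v hv w hw hva hwa
    obtain ⟨p, hp, q, hq, hpF, hqF, hb⟩ := hF {v, w} card_le_two
    simp only [mem_insert, mem_singleton, not_or] at hpF hqF
    exact hb.2 (claimIII hc hk hcle (rP v hv) (rQ w hw) hva hwa.symm (nPQ v hv w hw)
      ⟨fun hh => nZP a ha a (PP hh) rfl, fun hh => nZQ a ha a (QQ hh) rfl⟩ hp hq hb.1 hpF.1 hpF.2 hqF.1 hqF.2)
  · intro a ha b hb hab v hv w hw hva hwb z hz haz hbz
    obtain ⟨p, hp, q, hq, hpq⟩ := hB ((P.filter (G.Adj w)) \ {v}) ((Q.filter (G.Adj v)) \ {w})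
      (sdiff_subset.trans (filter_subset _ _)) (sdiff_subset.trans (filter_subset _ _))
      (nbr w P v ((mQ w).1 hw).2 uP) (nbr v Q w ((mP v).1 hv).2 uQ)
    simp only [mem_sdiff, mem_filter, mem_singleton] at hp hq
    have hd : ∀ x ∈ ({a, b, z} : Finset (Fin n)), ∀ y ∈ ({v, w, p, q} : Finset (Fin n)), x ≠ y := by
      intro x hx y hy
      simp only [mem_insert, mem_singleton] at hx hy
      have hx' : x ∈ Z := by
        rcases hx with rfl | rfl | rfl
        · exact ha
        · exact hb
        · exact KZ hz
      rcases hy with rfl | rfl | rfl | rfl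
      · exact nZP _ hx' _ hv
      · exact nZQ _ hx' _ hw
      · exact nZP _ hx' _ (PP hp.1.1)
      · exact nZQ _ hx' _ (QQ hq.1.1)
    exact hpq.symm.2 (claimIVa hK hcK hk hcle (rZ a ha) (rZ b hb) hab haz hbz hva hwb hq.1.2.symm
      hp.1.2 hpq.1.symm hd (nPQ v hv w hw) (Ne.symm hp.2) (Ne.symm hq.2))
  · intro a ha b hb hab v hv w hw hva hwb hvw
    exact hvw.2 (claimIVb hK hcK hk hcle (rZ a ha) (rZ b hb) hab hva hwb hvw.1 (nZQ a ha w hw) (nZP b hb v hv))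
  · intro a ha b hb hab v hv w hw hne hva hwb q hq hwq hvq
    exact hvq.2 (claimV hK hcK hk hcle (rZ a ha) (rZ b hb) hab hva hwb hne (nZP a ha w hw) (nZP b hb v hv)
      (nZQ a ha q hq) (nZQ b hb q hq) hvq.1 hwq)
  · intro a ha b hb hab v hv w hw hne hva hwb q hq hwq hvq
    exact hvq.2 (claimV hK hcK hk hcle (rZ a ha) (rZ b hb) hab hva hwb hne (nZQ a ha w hw) (nZQ b hb v hv)
      (nZP a ha q hq) (nZP b hb q hq) hvq.1 hwq)
  · exact fun a ha b hb hab => hab.2 (Z_red hK hcK hk hcle (rZ a ha) (rZ b hb) hab.1)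
  · have := card_le_card PP; linarith
  · have := card_le_card QQ; linarith
  · have : #(univ \ (Z ∪ P' ∪ Q')) ≤ #O := by
      rw [hO]
      refine card_le_card (sdiff_subset_sdiff (Subset.refl _) ?_)
      exact union_subset_union (union_subset_union KZ PP) QQ
    refine this.trans ?_
    clear sZ sP sQ uP uQ
    omega

end casetwo

section counting
open Finset

theorem f_mul (a b : ℕ) : a * b ≤ (a + b)^2 / 4 := by
  rw [Nat.le_div_iff_mul_le (by norm_num)]
  zify; nlinarith [sq_nonneg ((a:ℤ) - b)]

theorem f_mul' (a b : ℕ) : a * b + (a + b) / 2 ≤ (a + b + 1)^2 / 4 := by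
  rw [Nat.le_div_iff_mul_le (by norm_num)]
  have h : 2 * ((a + b) / 2) ≤ a + b := by omega
  zify at h ⊢
  nlinarith [sq_nonneg ((a:ℤ) - b)]

/-- `2 f(u+w) ≥ 2 f(u) + u w` -/
theorem f_add (u w : ℕ) : 2 * (u^2/4) + u * w ≤ 2 * ((u + w)^2/4) := by
  rcases Nat.eq_zero_or_pos w with rfl | hw
  · simp
  · have h1 : (u + w)^2 ≤ 4 * ((u + w)^2/4) + 1 := by
      have h : (u + w)^2 % 4 ≤ 1 := by
        rcases Nat.even_or_odd (u + w) with ⟨m, hm⟩ | ⟨m, hm⟩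
        · rw [hm]; ring_nf; omega
        · rw [hm]; ring_nf; omega
      omega
    have h2 : 4 * (u^2/4) ≤ u^2 := by omega
    nlinarith

theorem f_add' (u w : ℕ) : 4 * (u^2/4) + 2 * u * w + w^2 ≤ 4 * ((u + w)^2/4) + 1 := by
  have h1 : (u + w)^2 ≤ 4 * ((u + w)^2/4) + 1 := by
    have h : (u + w)^2 % 4 ≤ 1 := by
      rcases Nat.even_or_odd (u + w) with ⟨m, hm⟩ | ⟨m, hm⟩
      · rw [hm]; ring_nf; omega
      · rw [hm]; ring_nf; omega
    omega
  have h2 : 4 * (u^2/4) ≤ u^2 := by omega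
  nlinarith

theorem num_c2 (n D R u b l x dL g w0 : ℕ) (hR : 1000 * R ≤ n) (hD : 1000 * D ≤ R)
    (hl : l ≤ 3 * D) (hxb : x ≤ 2 * b) (hb0 : 1 ≤ b) (hn : 10^6 ≤ n)
    (hu : n ≤ 3 * (u + x) + 6 * D) (hdL : 6 * dL + 6 * R ≤ n)
    (h : 4 * g + 2 * u * (l + b) + (l + b)^2 ≤ 4 * w0 + 1) :
    g + x * (7 * R) + l * dL ≤ w0 := by
  have k1 : x * R ≤ 2 * b * R := Nat.mul_le_mul_right _ hxb
  have k2 : l * (6 * dL + 6 * R) ≤ l * n := Nat.mul_le_mul_left _ hdL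
  have k3 : b * n ≤ b * (3 * (u + x) + 6 * D) := Nat.mul_le_mul_left _ hu
  have k4 : l * n ≤ l * (3 * (u + x) + 6 * D) := Nat.mul_le_mul_left _ hu
  have k5 : l * x ≤ l * (2 * b) := Nat.mul_le_mul_left _ hxb
  have k6 : b * x ≤ b * (2 * b) := Nat.mul_le_mul_left _ hxb
  have k7 : l * b ≤ 3 * D * b := Nat.mul_le_mul_right _ hl
  have k8 : b * (1000 * D) ≤ b * R := Nat.mul_le_mul_left _ hD
  have k9 : b * (1000 * R) ≤ b * n := Nat.mul_le_mul_left _ hR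
  have k10 : l * (1000 * D) ≤ l * R := Nat.mul_le_mul_left _ hD
  have k11 : 1 * 10^6 ≤ b * n := Nat.mul_le_mul hb0 hn
  nlinarith

theorem num_c2' (n D R u l dL g w0 : ℕ) (hD : 1000 * D ≤ R)
    (hu : n ≤ 3 * u + 6 * D) (hdL : 6 * dL + 6 * R ≤ n)
    (h : 2 * g + u * l ≤ 2 * w0) :
    g + l * dL ≤ w0 := by
  have : l * (6 * dL) ≤ l * (3 * u) := Nat.mul_le_mul_left _ (by omega)
  nlinarith

theorem num_c1 (n D R u b l x dL dX g w0 z a e : ℕ) (hR : 1000 * R ≤ n) (hD : 1000 * D ≤ R)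
    (hl : l ≤ 3 * D) (hxa : x ≤ 3 * a) (ha : 1 ≤ a)
    (hz : 2 * n ≤ 3 * z + 3 * D) (hdX : 6 * dX ≤ n + 18 * R)
    (hu : n ≤ 3 * (u + x) + 6 * D) (hdL : 6 * dL + 6 * R ≤ n)
    (h : 2 * g + u * (l + b) ≤ 2 * w0)
    (he : e + z ≤ z * z + 2 * g + 2 * (x * dX) + 2 * (l * dL)) :
    e + (z + a) ≤ (z + a) * (z + a) + 2 * w0 := by
  have k0 : x * (2 * n) ≤ x * (3 * z + 3 * D) := Nat.mul_le_mul_left _ hz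
  have k1 : x * z ≤ 3 * a * z := Nat.mul_le_mul_right _ hxa
  have k2 : x * (6 * dX) ≤ x * (n + 18 * R) := Nat.mul_le_mul_left _ hdX
  have k3 : l * (6 * dL + 6 * R) ≤ l * n := Nat.mul_le_mul_left _ hdL
  have k4 : l * n ≤ l * (3 * (u + x) + 6 * D) := Nat.mul_le_mul_left _ hu
  have k5 : l * x ≤ 3 * D * x := Nat.mul_le_mul_right _ hl
  have k6 : x * (1000 * R) ≤ x * n := Nat.mul_le_mul_left _ hR
  have k7 : x * (1000 * D) ≤ x * R := Nat.mul_le_mul_left _ hD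
  have k8 : l * (1000 * D) ≤ l * R := Nat.mul_le_mul_left _ hD
  have k9 : 1 * a ≤ a * a := Nat.mul_le_mul_right _ ha
  nlinarith

theorem num_h (n s j : ℕ) (hj : 3 * (s + 1 + j) + 10 ≤ 2 * n)
    (hs : (n - s) * (n - s - 1) + 2 * ((s+1)^2/4) ≤ 2 * (n^2/4)) (m : ℕ) (hm : m + (s + 1 + j) = n + 1) :
    m * m + 2 * ((s + 1 + j)^2/4) ≤ 2 * (n^2/4) + m := by
  obtain ⟨m', rfl⟩ : ∃ m', m = m' + 1 := ⟨m - 1, by omega⟩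
  have e1 : n - s = m' + 1 + j := by omega
  have e2 : n - s - 1 = m' + j := by omega
  rw [e1] at hs
  rw [show m' + 1 + j - 1 = m' + j by omega] at hs
  rcases Nat.eq_zero_or_pos j with rfl | hj0
  · simp only [add_zero] at hs ⊢
    nlinarith
  · have g1 : (s+1)^2 ≤ 4 * ((s+1)^2/4) + 3 := by omega
    have g2 : 4 * ((s+1+j)^2/4) ≤ (s+1+j)^2 := by omega
    have g3 : j * (3 * (s + 1 + j) + 10) ≤ j * (2 * n) := Nat.mul_le_mul_left _ hj
    have g4 : n = m' + s + 1 + j := by omega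
    generalize (s+1)^2/4 = A at *
    generalize (s+1+j)^2/4 = B at *
    generalize n^2/4 = C at *
    subst g4
    nlinarith

theorem final_num (n D R s z r x l dX dL e bl : ℕ) (hn : 10^9 ≤ n) (hD : D = n / 10^6) (hR : R = n / 1000)
    (hsum : z + r + x + l = n) (hx : x = 0 ∨ 2 ≤ x) (hl : l ≤ 3 * D)
    (hz : 2 * n ≤ 3 * z + 3 * D) (hu : n ≤ 3 * (r + x) + 6 * D)
    (hdX : 6 * dX ≤ n + 18 * R) (hdL : 6 * dL + 6 * R ≤ n)
    (he : e + z ≤ z * z + 2 * ((r+1)^2/4) + 2 * (x * dX) + 2 * (l * dL))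
    (hbl : bl ≤ 2 * ((r+1)^2/4) + 2 * (x * (7 * R)) + 2 * (l * dL))
    (hs : (n - s) * (n - s - 1) + 2 * ((s+1)^2/4) ≤ 2 * (n^2/4))
    (he0 : e = 2 * (n^2/4 + 1)) : bl ≤ 2 * (s^2/4) := by
  by_contra hcon
  rw [not_le] at hcon
  obtain ⟨a, b, hab, hb, hxa, ha⟩ : ∃ a b, a + b = x ∧ x ≤ 2 * b ∧ x ≤ 3 * a ∧ (x = 0 ∨ 1 ≤ a) :=
    ⟨x / 2, x - x / 2, by omega, by omega, by omega, by omega⟩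
  have hDR : 1000 * D ≤ R := by omega
  have hRn : 1000 * R ≤ n := by omega
  have hbl2 : bl ≤ 2 * ((r + 1 + (l + b))^2/4) := by
    rcases hx with rfl | hx
    · have b0 : b = 0 := by omega
      subst b0
      have := num_c2' n D R (r+1) l dL _ _ hDR (by omega) hdL (f_add (r+1) l)
      simp only [add_zero]
      omega
    · have := num_c2 n D R (r+1) b l x dL _ _ hRn hDR hl hb (by omega) (by omega) (by omega) hdL (f_add' (r+1) (l+b))
      omega
  have he2 : e + (z + a) ≤ (z + a) * (z + a) + 2 * ((r + 1 + (l + b))^2/4) := by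
    rcases hx with rfl | hx
    · have b0 : b = 0 := by omega
      have a0 : a = 0 := by omega
      subst b0; subst a0
      have := num_c2' n D R (r+1) l dL _ _ hDR (by omega) hdL (f_add (r+1) l)
      simp only [add_zero]
      omega
    · exact num_c1 n D R (r+1) b l x dL dX _ _ z a e hRn hDR hl hxa (by omega) hz hdX (by omega) hdL
        (f_add (r+1) (l+b)) he
  have hlt : s < r + 1 + (l + b) := by
    by_contra hc
    rw [not_lt] at hc
    have : (r + 1 + (l + b))^2/4 ≤ s^2/4 := Nat.div_le_div_right (Nat.pow_le_pow_left hc 2)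
    omega
  obtain ⟨j, hj⟩ : ∃ j, r + 1 + (l + b) = s + 1 + j := ⟨r + 1 + (l + b) - s - 1, by omega⟩
  rw [hj] at he2
  have := num_h n s j (by omega) hs (z + a) (by omega)
  omega

end counting

section counting2
open Finset

variable {V : Type*} [DecidableEq V] {G : SimpleGraph V}

theorem eo_union_le (A B C : Finset V) : eo G (A ∪ B) C ≤ eo G A C + eo G B C := by
  rw [← union_sdiff_self_eq_union, eo_union_left C disjoint_sdiff]
  have := eo_mono (G := G) (sdiff_subset : B \ A ⊆ B) (Subset.refl C)
  omega

theorem dg_self {v : V} {S : Finset V} (h : v ∈ S) : dg G v S + 1 ≤ #S := by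
  have : S.filter (G.Adj v) ⊆ S.erase v := by
    intro w hw
    rw [mem_filter] at hw
    rw [mem_erase]
    exact ⟨hw.2.ne', hw.1⟩
  have := card_le_card this
  have h2 := card_erase_add_one h
  unfold dg
  omega

theorem eo_self (S : Finset V) : eo G S S + #S ≤ #S * #S := by
  unfold eo
  rw [← smul_eq_mul, ← sum_const, card_eq_sum_ones, ← sum_add_distrib]
  refine sum_le_sum fun v hv => ?_
  have := dg_self (G := G) hv
  rwa [card_eq_sum_ones] at this

/-- no common neighbour in `K` costs many edges -/
theorem eo_save {Z K : Finset V} (hKZ : K ⊆ Z) {a b : V} (ha : a ∈ Z) (hb : b ∈ Z) (hab : a ≠ b)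
    (h : ∀ z ∈ K, G.Adj a z → ¬ G.Adj b z) : eo G Z Z + 2 * #K + #Z ≤ #Z * #Z + 6 := by
  have hsub : ({a, b} : Finset V) ⊆ Z := by
    intro x hx
    simp only [mem_insert, mem_singleton] at hx
    rcases hx with rfl | rfl <;> assumption
  have hc2 : #({a, b} : Finset V) = 2 := card_pair hab
  have e1 : eo G Z Z = eo G ({a, b} ∪ (Z \ {a, b})) ({a, b} ∪ (Z \ {a, b})) := by
    rw [union_sdiff_of_subset hsub]
  rw [eo_union_self disjoint_sdiff] at e1
  have e2 := eo_self (G := G) (Z \ {a, b})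
  have e3 := card_sdiff_add_card_eq_card hsub
  have e4 : eo G {a, b} {a, b} + eo G {a, b} (Z \ {a, b}) = dg G a Z + dg G b Z := by
    rw [← eo_union_right _ disjoint_sdiff, union_sdiff_of_subset hsub]
    unfold eo
    rw [sum_pair hab]
  have e5 : dg G a K + dg G b K ≤ #K := by
    unfold dg
    rw [← card_union_of_disjoint]
    · exact card_le_card (union_subset (filter_subset _ _) (filter_subset _ _))
    · rw [Finset.disjoint_left]
      intro z hz hz'
      rw [mem_filter] at hz hz'
      exact h z hz.1 hz.2 hz'.2
  have e6 := dg_sdiff (G := G) a hKZ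
  have e7 := dg_sdiff (G := G) b hKZ
  have e8 := dg_le (G := G) a (Z \ K)
  have e9 := dg_le (G := G) b (Z \ K)
  have e10 := card_sdiff_add_card_eq_card hKZ
  generalize #(Z \ {a, b}) = y at *
  have hy : #Z = y + 2 := by omega
  rw [hy]
  rw [hy] at e10
  have : (y + 2) * (y + 2) = y * y + 4 * y + 4 := by ring
  omega

/-- vertices of `P` with a neighbour in `Z` -/
noncomputable def hit (G : SimpleGraph V) (P Z : Finset V) : Finset V := P.filter fun v => ∃ b ∈ Z, G.Adj v b

theorem mem_hit {P Z : Finset V} {v : V} : v ∈ hit G P Z ↔ v ∈ P ∧ ∃ b ∈ Z, G.Adj v b := by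
  unfold hit; exact mem_filter

theorem hit_sub (P Z : Finset V) : hit G P Z ⊆ P := filter_subset _ _

theorem side (P Z : Finset V) (T : ℕ) (hT : ∀ v ∈ P, dg G v Z ≤ T) :
    ∃ X ⊆ P, (#X = 0 ∨ 2 ≤ #X) ∧
      (∀ v ∈ X, ∃ w ∈ P, v ≠ w ∧ ∃ a ∈ Z, ∃ b ∈ Z, a ≠ b ∧ G.Adj v a ∧ G.Adj w b) ∧
      (eo G (P \ X) Z = 0 ∨ (X = ∅ ∧
        (eo G P Z ≤ #(hit G P Z) ∨
          (#(hit G P Z) ≤ 1 ∧ eo G P Z ≤ T)))) := by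
  set P1 := hit G P Z with hP1
  have hz : eo G (P \ P1) Z = 0 := by
    apply eo_eq_zero
    intro v hv b hb hvb
    rw [mem_sdiff] at hv
    exact hv.2 (mem_hit.2 ⟨hv.1, b, hb, hvb⟩)
  by_cases hB : ∃ v ∈ P, ∃ w ∈ P, v ≠ w ∧ ∃ a ∈ Z, ∃ b ∈ Z, a ≠ b ∧ G.Adj v a ∧ G.Adj w b
  · refine ⟨P1, hit_sub _ _, Or.inr ?_, ?_, Or.inl hz⟩
    · obtain ⟨v, hv, w, hw, hne, a, ha, b, hb, -, hva, hwb⟩ := hB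
      exact one_lt_card.2 ⟨v, mem_hit.2 ⟨hv, a, ha, hva⟩, w, mem_hit.2 ⟨hw, b, hb, hwb⟩, hne⟩
    · obtain ⟨v, hv, w, hw, hne, a, ha, b, hb, hab, hva, hwb⟩ := hB
      intro u hu
      obtain ⟨hu, d, hd, hud⟩ := mem_hit.1 hu
      by_cases h1 : u = v
      · subst h1; exact ⟨w, hw, hne, a, ha, b, hb, hab, hva, hwb⟩
      by_cases h2 : u = w
      · subst h2; exact ⟨v, hv, h1, b, hb, a, ha, hab.symm, hwb, hva⟩
      by_cases h3 : d = a
      · exact ⟨w, hw, h2, d, hd, b, hb, h3 ▸ hab, hud, hwb⟩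
      · exact ⟨v, hv, h1, d, hd, a, ha, h3, hud, hva⟩
  · refine ⟨∅, empty_subset _, Or.inl card_empty, by simp, Or.inr ⟨rfl, ?_⟩⟩
    have hsub : P1 ⊆ P := hit_sub _ _
    have e1 : eo G P Z = eo G P1 Z := by
      conv_lhs => rw [← union_sdiff_of_subset hsub]
      rw [eo_union_left _ disjoint_sdiff, hz, add_zero]
    rcases Nat.lt_or_ge 1 #P1 with h1 | h1
    · left
      rw [e1, ← mul_one #P1]
      apply eo_le_of_dg
      intro v hv
      by_contra hc
      rw [not_le] at hc
      obtain ⟨b, hb, b', hb', hbb⟩ := one_lt_card.1 hc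
      rw [mem_filter] at hb hb'
      obtain ⟨u, hu, huv⟩ := exists_mem_ne h1 v
      obtain ⟨hu, d, hd, hud⟩ := mem_hit.1 hu
      apply hB
      by_cases h3 : d = b
      · exact ⟨u, hu, v, hsub hv, huv, d, hd, b', hb'.1, h3 ▸ hbb, hud, hb'.2⟩
      · exact ⟨u, hu, v, hsub hv, huv, d, hd, b, hb.1, h3, hud, hb.2⟩
    · right
      refine ⟨h1, ?_⟩
      rw [e1]
      have : eo G P1 Z ≤ #P1 * T := eo_le_of_dg fun v hv => hT v (hsub hv)
      have h2 : #P1 * T ≤ 1 * T := Nat.mul_le_mul_right _ h1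
      omega

theorem eo_tri {Z P Q : Finset V} (h1 : Disjoint Z P) (h2 : Disjoint Z Q) (h3 : Disjoint P Q)
    (iP : ∀ v ∈ P, ∀ w ∈ P, ¬ G.Adj v w) (iQ : ∀ v ∈ Q, ∀ w ∈ Q, ¬ G.Adj v w) :
    eo G (Z ∪ P ∪ Q) (Z ∪ P ∪ Q) = eo G Z Z + 2 * (eo G P Z + eo G Q Z + eo G P Q) := by
  have h4 : Disjoint (Z ∪ P) Q := by rw [disjoint_union_left]; exact ⟨h2, h3⟩
  rw [eo_union_self h4, eo_union_self h1, eo_union_left _ h1, eo_eq_zero iP, eo_eq_zero iQ,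
    eo_symm Z P, eo_symm Z Q]
  ring

theorem blue_pairs {k : ℕ} {P Q P1 Q1 : Finset V} (hP : P1 ⊆ P) (hQ : Q1 ⊆ Q)
    (h : ∀ v ∈ P1, ∀ w ∈ Q1, ¬ (Bl G k).Adj v w) : eo (Bl G k) P Q + #P1 * #Q1 ≤ #P * #Q := by
  rw [eo_eq_card, ← card_product, ← card_product, ← card_union_of_disjoint]
  · exact card_le_card (union_subset (filter_subset _ _) (product_subset_product hP hQ))
  · rw [Finset.disjoint_left]
    intro p hp hp'
    rw [mem_product] at hp'
    exact h _ hp'.1 _ hp'.2 (mem_filter.1 hp).2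

end counting2

section counting3
open Finset

variable {n k D R : ℕ} {G : SimpleGraph (Fin n)} {K Z P Q L : Finset (Fin n)}

theorem exists_of_eo {V : Type*} {G : SimpleGraph V} {A B : Finset V} (h : eo G A B ≠ 0) :
    ∃ a ∈ A, ∃ b ∈ B, G.Adj a b := by
  by_contra! hc
  exact h (eo_eq_zero hc)

/-- one sided estimate -/
theorem one_side (p q p1 m R : ℕ) (hp1 : p1 ≤ p) (hp : 4 * R ≤ p) (h : m ≤ p1 ∨ (p1 ≤ 1 ∧ m ≤ 2 * R)) :
    m + p * q ≤ (p + q + 1)^2/4 := by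
  rcases h with h | h
  · have := f_mul p (q + 1)
    rw [mul_add, mul_one, ← add_assoc] at this
    omega
  · have := f_mul' p q
    omega

theorem two_sides (p q p1 q1 mp mq R b : ℕ) (hp1 : 1 ≤ p1) (hq1 : 1 ≤ q1) (hp : 8 * R + 2 ≤ p)
    (h : mp ≤ p1 ∨ (p1 ≤ 1 ∧ mp ≤ 2 * R)) (h' : mq ≤ q1 ∨ (q1 ≤ 1 ∧ mq ≤ 2 * R))
    (hb : b + p1 * q1 ≤ p * q) :
    mp + mq + b ≤ (p + q + 1)^2/4 := by
  have h1 := f_mul' p q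
  have h2 : p1 + q1 ≤ p1 * q1 + 1 := by nlinarith
  rcases h with h | ⟨h, h3⟩ <;> rcases h' with h' | ⟨h', h4⟩
  · omega
  · have : q1 = 1 := by omega
    subst this; omega
  · have : p1 = 1 := by omega
    subst this; omega
  · have : p1 = 1 := by omega
    subst this; omega

theorem core_count (h : St G k D R K Z P Q L) (hD : D = n / 10^6) (hR : R = n / 1000) (hn : 10^9 ≤ n) :
    ∃ X ⊆ P, ∃ Y ⊆ Q, (#X = 0 ∨ 2 ≤ #X) ∧ (#Y = 0 ∨ 2 ≤ #Y) ∧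
      (∀ v ∈ X, ∃ w ∈ P, v ≠ w ∧ ∃ a ∈ Z, ∃ b ∈ Z, a ≠ b ∧ G.Adj v a ∧ G.Adj w b) ∧
      (∀ v ∈ Y, ∃ w ∈ Q, v ≠ w ∧ ∃ a ∈ Z, ∃ b ∈ Z, a ≠ b ∧ G.Adj v a ∧ G.Adj w b) ∧
      eo G Z Z + #Z + 2 * (eo G (P \ X) Z + eo G (Q \ Y) Z + eo G (P \ X) (Q \ Y)) ≤
        #Z * #Z + 2 * ((#(P \ X) + #(Q \ Y) + 1)^2/4) ∧
      (eo (Bl G k) (P \ X) Z + eo (Bl G k) (Q \ Y) Z + eo (Bl G k) (P \ X) (Q \ Y)) ≤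
        (#(P \ X) + #(Q \ Y) + 1)^2/4 := by
  obtain ⟨X, hX, hX2, hXb, hXe⟩ := side (G := G) P Z (2 * R) h.mP
  obtain ⟨Y, hY, hY2, hYb, hYe⟩ := side (G := G) Q Z (2 * R) h.mQ
  refine ⟨X, hX, Y, hY, hX2, hY2, hXb, hYb, ?_⟩
  have eZ := eo_self (G := G) Z
  have b1 := eo_mono_graph (Bl_le (G := G) k) (P \ X) Z
  have b2 := eo_mono_graph (Bl_le (G := G) k) (Q \ Y) Z
  have b3 := eo_mono_graph (Bl_le (G := G) k) (P \ X) (Q \ Y)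
  have g3 := eo_le (G := G) (P \ X) (Q \ Y)
  have lP := h.lP
  have lQ := h.lQ
  by_cases m1 : eo G (P \ X) Z = 0
  · by_cases m2 : eo G (Q \ Y) Z = 0
    · have := f_mul' #(P \ X) #(Q \ Y)
      rw [m1] at b1 ⊢
      rw [m2] at b2 ⊢
      constructor <;> omega
    · obtain ⟨rfl, hYf⟩ := hYe.resolve_left m2
      clear hYe
      rw [sdiff_empty] at *
      have := one_side #Q #(P \ X) _ _ R (card_le_card (hit_sub _ _)) (by omega) hYf
      rw [mul_comm, add_comm #Q] at this
      constructor <;> omega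
  · obtain ⟨rfl, hXf⟩ := hXe.resolve_left m1
    clear hXe
    rw [sdiff_empty] at *
    by_cases m2 : eo G (Q \ Y) Z = 0
    · have := one_side #P #(Q \ Y) _ _ R (card_le_card (hit_sub _ _)) (by omega) hXf
      constructor <;> omega
    · obtain ⟨rfl, hYf⟩ := hYe.resolve_left m2
      clear hYe
      rw [sdiff_empty] at *
      obtain ⟨v, hv, a, ha, hva⟩ := exists_of_eo m1
      obtain ⟨w, hw, b, hb, hwb⟩ := exists_of_eo m2
      have hab : a ≠ b := by
        rintro rfl
        exact h.c3 a ha v hv w hw hva hwb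
      have hsave := eo_save (G := G) h.KZ ha hb hab (h.c4a a ha b hb hab v hv w hw hva hwb)
      have hp1 : 1 ≤ #(hit G P Z) :=
        card_pos.2 ⟨v, mem_hit.2 ⟨hv, a, ha, hva⟩⟩
      have hq1 : 1 ≤ #(hit G Q Z) :=
        card_pos.2 ⟨w, mem_hit.2 ⟨hw, b, hb, hwb⟩⟩
      have hp1' : #(hit G P Z) ≤ #P := card_le_card (hit_sub _ _)
      have hq1' : #(hit G Q Z) ≤ #Q := card_le_card (hit_sub _ _)
      have hbp := blue_pairs (G := G) (k := k) (hit_sub P Z)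
        (hit_sub Q Z) (by
          intro v hv w hw
          obtain ⟨hv, a, ha, hva⟩ := mem_hit.1 hv
          obtain ⟨hw, b, hb, hwb⟩ := mem_hit.1 hw
          refine h.c4b a ha b hb ?_ v hv w hw hva hwb
          rintro rfl
          exact h.c3 a ha v hv w hw hva hwb)
      have t2 := two_sides #P #Q _ _ _ _ R _ hp1 hq1 (by omega) hXf hYf hbp
      have sK := h.sK
      have sP := h.sP
      have sQ := h.sQ
      have t1 := f_mul' #P #Q
      constructor
      · omega
      · omega

end counting3

section final_case
open Finset

variable {n k D R : ℕ} {G : SimpleGraph (Fin n)} {K Z P Q L : Finset (Fin n)}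

theorem dg_four {H : SimpleGraph (Fin n)} (un : (Z ∪ P ∪ Q) ∪ L = univ) (v : Fin n) :
    dg H v univ ≤ dg H v Z + dg H v P + dg H v Q + dg H v L := by
  rw [← un]
  have h1 := dg_union_le (G := H) v (Z ∪ P ∪ Q) L
  have h2 := dg_union_le (G := H) v (Z ∪ P) Q
  have h3 := dg_union_le (G := H) v Z P
  omega

theorem dg_mono_graph {H H' : SimpleGraph (Fin n)} (h : H ≤ H') (v : Fin n) (S : Finset (Fin n)) :
    dg H v S ≤ dg H' v S := by
  refine card_le_card fun w hw => ?_
  rw [mem_filter] at hw ⊢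
  exact ⟨hw.1, h hw.2⟩

theorem dg_excl {H H' : SimpleGraph (Fin n)} {v w : Fin n} {S : Finset (Fin n)}
    (h : ∀ q ∈ S, H.Adj w q → ¬ H'.Adj v q) : dg H' v S + dg H w S ≤ #S := by
  unfold dg
  rw [← card_union_of_disjoint]
  · exact card_le_card (union_subset (filter_subset _ _) (filter_subset _ _))
  · rw [Finset.disjoint_left]
    intro q hq hq'
    rw [mem_filter] at hq hq'
    exact h q hq.1 hq'.2 hq.2

theorem num_dX {n D R z q l d : ℕ} (hn : 10^9 ≤ n) (hD : D = n / 10^6) (hR : R = n / 1000)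
    (h1 : z ≤ 2 * R) (h2 : 6 * q ≤ n + 30 * D) (h3 : l ≤ 3 * D) (h : d ≤ z + 0 + q + l) :
    d ≤ (n + 18 * R) / 6 := by omega

theorem num_bX {n D R z q w c l d : ℕ} (hn : 10^9 ≤ n) (hD : D = n / 10^6) (hR : R = n / 1000)
    (h1 : z ≤ 2 * R) (h2 : 6 * c ≤ n + 30 * D) (h3 : l ≤ 3 * D) (h : d ≤ z + 0 + q + l)
    (h4 : q + w ≤ c) (h5 : n ≤ 6 * w + 24 * R) :
    d ≤ 7 * R := by omega

theorem deg_X (hn : 10^9 ≤ n) (hD : D = n / 10^6) (hR : R = n / 1000)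
    (un : (Z ∪ P ∪ Q) ∪ L = univ) (indP : ∀ v ∈ P, ∀ w ∈ P, ¬ G.Adj v w)
    (mP : ∀ v ∈ P, dg G v Z ≤ 2 * R) (sQ : 6 * #Q ≤ n + 30 * D) (sL : #L ≤ 3 * D)
    {v : Fin n} (hv : v ∈ P) : dg G v univ ≤ (n + 18 * R) / 6 := by
  have h := dg_four (H := G) un v
  rw [dg_eq_zero (indP v hv)] at h
  have hq := dg_le (G := G) v Q
  have hl := dg_le (G := G) v L
  exact num_dX hn hD hR (mP v hv) sQ sL (h.trans (by omega))

theorem blue_X (hn : 10^9 ≤ n) (hD : D = n / 10^6) (hR : R = n / 1000)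
    (un : (Z ∪ P ∪ Q) ∪ L = univ) (indP : ∀ v ∈ P, ∀ w ∈ P, ¬ G.Adj v w)
    (mP : ∀ v ∈ P, dg G v Z ≤ 2 * R) (sQ : 6 * #Q ≤ n + 30 * D) (sL : #L ≤ 3 * D)
    (nP : ∀ v ∈ P, n ≤ 6 * dg G v Q + 24 * R)
    (c5P : ∀ a ∈ Z, ∀ b ∈ Z, a ≠ b → ∀ v ∈ P, ∀ w ∈ P, v ≠ w → G.Adj v a → G.Adj w b → ∀ q ∈ Q,
      G.Adj w q → ¬ (Bl G k).Adj v q)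
    {v : Fin n} (hv : v ∈ P) 
    (hw : ∃ w ∈ P, v ≠ w ∧ ∃ a ∈ Z, ∃ b ∈ Z, a ≠ b ∧ G.Adj v a ∧ G.Adj w b) :
    dg (Bl G k) v univ ≤ 7 * R := by
  obtain ⟨w, hw, hvw, a, ha, b, hb, hab, hva, hwb⟩ := hw
  have h := dg_four (H := Bl G k) un v
  rw [dg_eq_zero (G := Bl G k) (fun w hw hh => indP v hv w hw (Bl_le k hh))] at h
  have hl := dg_le (G := Bl G k) v L
  have hq := dg_excl (c5P a ha b hb hab v hv w hw hvw hva hwb)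
  have hz := dg_mono_graph (Bl_le (G := G) k) v Z
  exact num_bX hn hD hR (hz.trans (mP v hv)) sQ (hl.trans sL) h hq (nP w hw)

set_option maxHeartbeats 1000000 in
theorem case2 (hn : 10^9 ≤ n) (hD : D = n / 10^6) (hR : R = n / 1000)
    (h : St G k D R K Z P Q L) (he : eo G univ univ = 2 * (n^2/4 + 1)) (s : ℕ)
    (hs : (n - s) * (n - s - 1) + 2 * ((s+1)^2/4) ≤ 2 * (n^2/4)) :
    eo (Bl G k) univ univ ≤ 2 * (s^2/4) := by
  obtain ⟨X, hX, Y, hY, X2, Y2, Xb, Yb, c1, c2⟩ := core_count h hD hR hn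
  have un' : (Z ∪ Q ∪ P) ∪ L = univ := by rw [union_right_comm Z Q P]; exact h.un
  have eX : eo G X univ ≤ #X * ((n + 18 * R) / 6) := eo_le_of_dg fun v hv =>
    deg_X hn hD hR h.un h.indP h.mP h.sQ h.sL (hX hv)
  have eY : eo G Y univ ≤ #Y * ((n + 18 * R) / 6) := eo_le_of_dg fun v hv =>
    deg_X hn hD hR un' h.indQ h.mQ h.sP h.sL (hY hv)
  have bX : eo (Bl G k) X univ ≤ #X * (7 * R) := eo_le_of_dg fun v hv =>
    blue_X hn hD hR h.un h.indP h.mP h.sQ h.sL h.nP h.c5P (hX hv) (Xb v hv)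
  have bY : eo (Bl G k) Y univ ≤ #Y * (7 * R) := eo_le_of_dg fun v hv =>
    blue_X hn hD hR un' h.indQ h.mQ h.sP h.sL h.nQ h.c5Q (hY hv) (Yb v hv)
  have eL : eo G L univ ≤ #L * ((n - 6 * R) / 6) := eo_le_of_dg fun v hv => by
    have := h.degL v hv
    omega
  have bL : eo (Bl G k) L univ ≤ #L * ((n - 6 * R) / 6) :=
    (eo_mono_graph (Bl_le (G := G) k) _ _).trans eL
  have d1 : Disjoint Z (P \ X) := h.dZP.mono_right sdiff_subset
  have d2 : Disjoint Z (Q \ Y) := h.dZQ.mono_right sdiff_subset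
  have d3 : Disjoint (P \ X) (Q \ Y) := h.dPQ.mono sdiff_subset sdiff_subset
  have hZ : ∀ v ∈ Z, v ∉ P ∧ v ∉ Q := fun v hv =>
    ⟨Finset.disjoint_left.1 h.dZP hv, Finset.disjoint_left.1 h.dZQ hv⟩
  have hPQ : ∀ v ∈ P, v ∉ Q := fun v hv => Finset.disjoint_left.1 h.dPQ hv
  have hLL : ∀ v ∈ L, v ∉ Z ∧ v ∉ P ∧ v ∉ Q := fun v hv => by
    have := Finset.disjoint_right.1 h.dL hv
    simp only [mem_union, not_or] at this
    exact ⟨this.1.1, this.1.2, this.2⟩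
  have hd : Disjoint (Z ∪ P \ X ∪ Q \ Y) (X ∪ Y ∪ L) := by
    rw [Finset.disjoint_left]
    intro v hv hv'
    simp only [mem_union, mem_sdiff] at hv hv'
    rcases hv' with (hv' | hv') | hv'
    · rcases hv with (hv | hv) | hv
      · exact (hZ v hv).1 (hX hv')
      · exact hv.2 hv'
      · exact hPQ v (hX hv') hv.1
    · rcases hv with (hv | hv) | hv
      · exact (hZ v hv).2 (hY hv')
      · exact hPQ v hv.1 (hY hv')
      · exact hv.2 hv'
    · obtain ⟨a1, a2, a3⟩ := hLL v hv'
      rcases hv with (hv | hv) | hv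
      · exact a1 hv
      · exact a2 hv.1
      · exact a3 hv.1
  have hu : (Z ∪ P \ X ∪ Q \ Y) ∪ (X ∪ Y ∪ L) = univ := by
    rw [eq_univ_iff_forall]
    intro v
    have := mem_univ v
    rw [← h.un] at this
    simp only [mem_union, mem_sdiff] at this ⊢
    by_cases g1 : v ∈ X
    · exact Or.inr (Or.inl (Or.inl g1))
    by_cases g2 : v ∈ Y
    · exact Or.inr (Or.inl (Or.inr g2))
    rcases this with ((g | g) | g) | g
    · exact Or.inl (Or.inl (Or.inl g))
    · exact Or.inl (Or.inl (Or.inr ⟨g, g1⟩))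
    · exact Or.inl (Or.inr ⟨g, g2⟩)
    · exact Or.inr (Or.inr g)
  have s1 := eo_split (G := G) _ _ hd hu
  have s2 := eo_split (G := Bl G k) _ _ hd hu
  rw [eo_tri d1 d2 d3 (fun v hv w hw => h.indP v (sdiff_subset hv) w (sdiff_subset hw))
    (fun v hv w hw => h.indQ v (sdiff_subset hv) w (sdiff_subset hw))] at s1
  rw [eo_tri d1 d2 d3 (fun v hv w hw hh => h.indP v (sdiff_subset hv) w (sdiff_subset hw) (Bl_le k hh))
    (fun v hv w hw hh => h.indQ v (sdiff_subset hv) w (sdiff_subset hw) (Bl_le k hh)),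
    eo_eq_zero h.redZ] at s2
  have u1 := eo_union_le (G := G) (X ∪ Y) L univ
  have u2 := eo_union_le (G := G) X Y univ
  have u3 := eo_union_le (G := Bl G k) (X ∪ Y) L univ
  have u4 := eo_union_le (G := Bl G k) X Y univ
  have q1 := card_sdiff_add_card_eq_card hX
  have q2 := card_sdiff_add_card_eq_card hY
  have q3 : #Z + #P + #Q + #L = n := by
    have := congrArg card h.un
    rw [card_union_of_disjoint h.dL, card_union_of_disjoint
      (by rw [disjoint_union_left]; exact ⟨h.dZQ, h.dPQ⟩), card_union_of_disjoint h.dZP,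
      card_univ, Fintype.card_fin] at this
    exact this
  have hKc := card_le_card h.KZ
  have hsK := h.sK
  have hlP := h.lP
  have hlQ := h.lQ
  refine final_num n D R s #Z (#(P \ X) + #(Q \ Y)) (#X + #Y) #L ((n + 18 * R) / 6)
    ((n - 6 * R) / 6) (eo G univ univ) _ hn hD hR (by omega) (by omega) h.sL (by omega) (by omega)
    (by omega) (by omega) ?_ ?_ hs he
  · rw [add_mul]; omega
  · rw [add_mul]; omega

end final_case

section main_lower
open Finset

theorem main_lower (k : ℕ) (hk : 3 ≤ k) : ∃ n0 : ℕ, ∀ n : ℕ, n0 ≤ n → ∀ G : SimpleGraph (Fin n),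
    eo G univ univ = 2 * (n^2/4 + 1) → ∀ s : ℕ, n ≤ 3 * s + 2 →
    (n - s) * (n - s - 1) + 2 * ((s+1)^2/4) ≤ 2 * (n^2/4) →
    eo (Bl G k) univ univ ≤ 2 * (s^2/4) := by
  obtain ⟨n0, h0⟩ := structure_thm k hk
  refine ⟨n0 + 10^9 * k + 10^30, fun n hn G he s hs1 hs => ?_⟩
  by_contra hcon
  rw [not_le] at hcon
  have hb : n^2 ≤ 18 * eo (Bl G k) univ univ + 5 * n := by
    have : s^2 ≤ 2 * eo (Bl G k) univ univ + 1 := by omega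
    obtain ⟨m, rfl⟩ : ∃ m, n = m + 2 := ⟨n - 2, by omega⟩
    have hm : m ≤ 3 * s := by omega
    clear hs he
    nlinarith
  have hn30 : 10^30 ≤ n := by omega
  have hbl : n^2 ≤ 20 * eo (Bl G k) univ univ := by nlinarith
  have hR : (1/18 - 10^(-22 : ℤ)) * (n : ℝ)^2 ≤ eo (Bl G k) univ univ := by
    have h1 : (n:ℝ)^2 ≤ 18 * (eo (Bl G k) univ univ : ℕ) + 5 * n := by exact_mod_cast hb
    have h2 : (10:ℝ)^30 ≤ n := by exact_mod_cast hn30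
    have h3 : (10:ℝ)^(-22 : ℤ) = 1/10^22 := by norm_num
    rw [h3]
    nlinarith
  rcases h0 n (by omega) G he hR with ⟨P, Q, h⟩ | ⟨K, P, Q, h⟩
  · exact case1 hk (by omega) h he hbl
  · obtain ⟨Z, P', Q', L, hS⟩ := struct2 hk (by omega) h (by omega) hbl _ _ rfl rfl
    have := case2 (by omega) rfl rfl hS he s hs
    omega

end main_lower

section edges
open Finset

theorem eo_univ {n : ℕ} (G : SimpleGraph (Fin n)) : eo G univ univ = 2 * G.edgeSet.ncard := by
  have h := G.sum_degrees_eq_twice_card_edges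
  rw [Set.ncard_eq_toFinset_card', ← edgeFinset]
  rw [← h]
  unfold eo dg
  refine sum_congr rfl fun v _ => ?_
  rw [← card_neighborFinset_eq_degree, neighborFinset_eq_filter]

theorem count_add {n : ℕ} (G : SimpleGraph (Fin n)) (k : ℕ) :
    countEdgesInC G (2 * k + 1) + (Bl G k).edgeSet.ncard = G.edgeSet.ncard := by
  unfold countEdgesInC
  rw [← Set.ncard_union_eq _ (Set.toFinite _) (Set.toFinite _)]
  · congr 1
    ext e
    induction e using Sym2.ind with
    | _ a b =>
      simp only [Set.mem_union, Set.mem_ofPred_eq, mem_edgeSet, Bl]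
      tauto
  · rw [Set.disjoint_left]
    intro e
    induction e using Sym2.ind with
    | _ a b =>
      simp only [Set.mem_ofPred_eq, mem_edgeSet, Bl]
      tauto

/-- complete bipartite block -/
def H0 (n c p : ℕ) : SimpleGraph (Fin n) where
  Adj a b := (c ≤ a.1 ∧ a.1 < c + p ∧ c + p ≤ b.1) ∨ (c ≤ b.1 ∧ b.1 < c + p ∧ c + p ≤ a.1)
  symm := ⟨fun a b h => h.symm⟩
  loopless := ⟨fun a h => by omega⟩

/-- clique block -/
def KK (n c : ℕ) : SimpleGraph (Fin n) where
  Adj a b := a ≠ b ∧ a.1 ≤ c ∧ b.1 ≤ c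
  symm := ⟨fun a b h => ⟨h.1.symm, h.2.2, h.2.1⟩⟩
  loopless := ⟨fun a h => h.1 rfl⟩

theorem H0_adj {n c p : ℕ} {a b : Fin n} : (H0 n c p).Adj a b ↔
    (c ≤ a.1 ∧ a.1 < c + p ∧ c + p ≤ b.1) ∨ (c ≤ b.1 ∧ b.1 < c + p ∧ c + p ≤ a.1) := Iff.rfl

theorem KK_adj {n c : ℕ} {a b : Fin n} : (KK n c).Adj a b ↔ a.1 ≠ b.1 ∧ a.1 ≤ c ∧ b.1 ≤ c := by
  rw [ne_eq, ← Fin.ext_iff]; rfl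

theorem H0_card {n c p : ℕ} (h : c + p < n) (hp : 0 < p) : eo (H0 n c p) univ univ = 2 * (p * (n - c - p)) := by
  rw [eo_eq_card]
  have : ((univ ×ˢ univ : Finset (Fin n × Fin n)).filter fun x => (H0 n c p).Adj x.1 x.2) =
      (Ico (⟨c, by omega⟩ : Fin n) ⟨c + p, h⟩ ×ˢ Ici (⟨c + p, h⟩ : Fin n)) ∪
      (Ici (⟨c + p, h⟩ : Fin n) ×ˢ Ico (⟨c, by omega⟩ : Fin n) ⟨c + p, h⟩) := by
    ext ⟨a, b⟩
    simp only [mem_filter, mem_product, mem_univ, true_and, mem_union, mem_Ico, mem_Ici, H0_adj,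
      Fin.le_def, Fin.lt_def]
    omega
  rw [this, card_union_of_disjoint, card_product, card_product, Fin.card_Ico, Fin.card_Ici]
  · have e1 : c + p - c = p := by omega
    have e2 : n - (c + p) = n - c - p := by omega
    simp only [e1, e2]
    ring
  · rw [Finset.disjoint_left]
    rintro ⟨a, b⟩ h1 h2
    simp only [mem_product, mem_Ico, mem_Ici, Fin.le_def, Fin.lt_def] at h1 h2
    omega

theorem KK_card {n c : ℕ} (h : c < n) : eo (KK n c) univ univ = (c + 1) * c := by
  rw [eo_eq_card]
  have : ((univ ×ˢ univ : Finset (Fin n × Fin n)).filter fun x => (KK n c).Adj x.1 x.2) =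
      (Iic (⟨c, h⟩ : Fin n)).offDiag := by
    ext ⟨a, b⟩
    simp only [mem_filter, mem_product, mem_univ, true_and, mem_offDiag, mem_Iic, KK_adj, ne_eq, Fin.ext_iff,
      Fin.le_def]
    tauto
  rw [this, offDiag_card, Fin.card_Iic]
  simp only
  rw [← Nat.mul_sub_one]
  simp

theorem path_block {n c p : ℕ} (hp : 0 < p) {G : SimpleGraph (Fin n)} (hG : G ≤ H0 n c p ⊔ KK n c) {a b : Fin n}
    (w : G.Walk a b) (hw : w.IsPath) (hb : c ≤ b.1) :
    (c ≤ a.1 → ((a.1 < c + p ↔ b.1 < c + p) ↔ Even w.length)) ∧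
    (a.1 < c → ∃ x ∈ w.support, x.1 = c) := by
  induction w with
  | nil => simp; omega
  | @cons a a' b h q ih =>
    rw [Walk.cons_isPath_iff] at hw
    obtain ⟨i1, i2⟩ := ih hw.1 hb
    have hadj := hG h
    rw [sup_adj, H0_adj, KK_adj] at hadj
    constructor
    · intro ha
      by_cases ha' : c ≤ a'.1
      · have i1 := i1 ha'
        rw [Walk.length_cons, Nat.even_add_one, ← i1]
        clear i1 i2 ih
        omega
      · exfalso
        obtain ⟨x, hx, hxc⟩ := i2 (by omega)
        have : x = a := by
          apply Fin.ext; omega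
        exact hw.2 (this ▸ hx)
    · intro ha
      rw [Walk.support_cons]
      by_cases ha' : c ≤ a'.1
      · exact ⟨a', List.mem_cons_of_mem _ q.start_mem_support, by omega⟩
      · obtain ⟨x, hx, hxc⟩ := i2 (by omega)
        exact ⟨x, List.mem_cons_of_mem _ hx, hxc⟩

theorem cycle_block {n c p : ℕ} (hp : 0 < p) {G : SimpleGraph (Fin n)} (hG : G ≤ H0 n c p ⊔ KK n c)
    {x : Fin n} (w : G.Walk x x) (hw : w.IsCycle) (hx : c < x.1) : Even w.length := by
  cases w with
  | nil => exact absurd hw (by simp)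
  | @cons _ a' _ h q =>
    rw [Walk.cons_isCycle_iff] at hw
    have i1 := (path_block hp hG q hw.1 hx.le).1
    have hadj := hG h
    rw [sup_adj, H0_adj, KK_adj] at hadj
    have i1 := i1 (by omega)
    rw [Walk.length_cons, Nat.even_add_one, ← i1]
    omega

theorem block_blue {n c p k : ℕ} (hp : 0 < p) {G : SimpleGraph (Fin n)} (hG : G ≤ H0 n c p ⊔ KK n c)
    {x y : Fin n} (h : (H0 n c p).Adj x y) : ¬ occursInC G (2 * k + 1) s(x, y) := by
  rintro ⟨u, w, hw, hl, he⟩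
  have key : ∀ z ∈ w.support, ¬ c < z.1 := by
    intro z hz hc
    have := cycle_block hp hG (w.rotate z hz) (hw.rotate hz) hc
    rw [Walk.length_rotate, hl] at this
    rw [Nat.even_iff] at this
    omega
  have h1 := key x (Walk.fst_mem_support_of_mem_edges _ he)
  have h2 := key y (Walk.snd_mem_support_of_mem_edges _ he)
  rw [H0_adj] at h
  omega

theorem upper (n c s N k : ℕ) (hcs : c + s = n) (hs : 2 ≤ s) (h1 : s^2/4 ≤ N)
    (h2 : 2 * N ≤ 2 * (s^2/4) + (c+1)*c) :
    ∃ G : SimpleGraph (Fin n), G.edgeSet.ncard = N ∧ countEdgesInC G (2*k+1) + s^2/4 ≤ N := by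
  obtain ⟨p, q, hpq, hp, hq, hsq⟩ : ∃ p q, p + q = s ∧ 0 < p ∧ 0 < q ∧ p * q = s^2/4 := by
    rcases Nat.even_or_odd' s with ⟨t, rfl | rfl⟩
    · refine ⟨t, t, by omega, by omega, by omega, ?_⟩
      have : (2 * t)^2 = 4 * (t * t) := by ring
      omega
    · refine ⟨t, t + 1, by omega, by omega, by omega, ?_⟩
      have : (2 * t + 1)^2 = 4 * (t * (t + 1)) + 1 := by ring
      omega
  have e0 := H0_card (n := n) (c := c) (p := p) (by omega) hp
  have e1 := KK_card (n := n) (c := c) (by omega)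
  rw [eo_univ, Set.ncard_eq_toFinset_card', ← edgeFinset] at e0 e1
  have hnq : n - c - p = q := by omega
  rw [hnq, hsq] at e0
  have hdis : Disjoint (H0 n c p).edgeFinset (KK n c).edgeFinset := by
    rw [Finset.disjoint_left]
    intro e
    induction e using Sym2.ind with
    | _ a b =>
      simp only [mem_edgeFinset, mem_edgeSet, H0_adj, KK_adj]
      omega
  obtain ⟨T, hT1, hT2, hT⟩ := exists_subsuperset_card_eq
    (subset_union_left : (H0 n c p).edgeFinset ⊆ (H0 n c p).edgeFinset ∪ (KK n c).edgeFinset)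
    (n := N) (by omega) (by rw [card_union_of_disjoint hdis]; omega)
  have hnd : ∀ e ∈ T, ¬ e.IsDiag := by
    intro e he
    have := hT2 he
    rw [mem_union, mem_edgeFinset, mem_edgeFinset] at this
    rcases this with h | h
    · exact not_isDiag_of_mem_edgeSet _ h
    · exact not_isDiag_of_mem_edgeSet _ h
  have hes : (fromEdgeSet (T : Set (Sym2 (Fin n)))).edgeSet = T := by
    rw [edgeSet_fromEdgeSet]
    ext e
    simp only [Set.mem_sdiff, mem_coe, Sym2.mem_diagSet]
    exact ⟨fun h => h.1, fun h => ⟨h, hnd e h⟩⟩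
  have hN : (fromEdgeSet (T : Set (Sym2 (Fin n)))).edgeSet.ncard = N := by
    rw [hes, Set.ncard_coe_finset, hT]
  obtain ⟨G, hGdef⟩ : ∃ G, G = fromEdgeSet (T : Set (Sym2 (Fin n))) := ⟨_, rfl⟩
  rw [← hGdef] at hes hN
  refine ⟨G, hN, ?_⟩
  have hca := count_add G k
  have hG : G ≤ H0 n c p ⊔ KK n c := by
    rw [← edgeSet_subset_edgeSet, hes, edgeSet_sup]
    intro e he
    have := hT2 he
    rw [mem_union, mem_edgeFinset, mem_edgeFinset] at this
    exact this
  have hle : H0 n c p ≤ Bl G k := by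
    intro a b hab
    refine ⟨?_, block_blue hp hG hab⟩
    rw [← mem_edgeSet, hes]
    exact hT1 (by rw [mem_edgeFinset]; exact hab)
  have := Set.ncard_le_ncard (edgeSet_subset_edgeSet.2 hle) (Set.toFinite _)
  rw [Set.ncard_eq_toFinset_card' (H0 n c p).edgeSet, ← edgeFinset] at this
  omega

theorem Fodd_eq (k : ℕ) (hk : 3 ≤ k) : ∃ n0 : ℕ, ∀ n : ℕ, n0 ≤ n → ∀ s : ℕ, 2 ≤ s → s ≤ n → n ≤ 3 * s + 2 →
    (n - s) * (n - s - 1) + 2 * ((s+1)^2/4) ≤ 2 * (n^2/4) →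
    2 * (n^2/4 + 1) ≤ 2 * (s^2/4) + (n - s + 1) * (n - s) →
    Fodd k n + s^2/4 = n^2/4 + 1 := by
  obtain ⟨n0, h0⟩ := main_lower k hk
  refine ⟨n0, fun n hn s hs2 hsn hs3 hs hs' => ?_⟩
  have hle : s^2/4 ≤ n^2/4 + 1 := by
    have : s^2 ≤ n^2 := Nat.pow_le_pow_left hsn 2
    omega
  obtain ⟨G, hG, hGc⟩ := upper n (n - s) s (n^2/4+1) k (by omega) hs2 hle hs'
  have hup : Fodd k n ≤ countEdgesInC G (2*k+1) := Nat.sInf_le ⟨G, hG, rfl⟩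
  have hne : {m : ℕ | ∃ G : SimpleGraph (Fin n),
    G.edgeSet.ncard = n ^ 2 / 4 + 1 ∧ countEdgesInC G (2 * k + 1) = m}.Nonempty := ⟨_, G, hG, rfl⟩
  obtain ⟨G', hG', hc'⟩ := Nat.sInf_mem hne
  have hlow := h0 n hn G' (by rw [eo_univ, hG']) s hs3 hs
  rw [eo_univ] at hlow
  have := count_add G' k
  have hF : countEdgesInC G' (2*k+1) = Fodd k n := hc'
  omega

end edges

theorem stmt12 :
    ∀ k : ℕ, 3 ≤ k → ∃ n₀ : ℕ, ∀ n : ℕ, n₀ ≤ n →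
      (n % 6 = 0 → (Fodd k n : ℝ) = 2 * (n : ℝ) ^ 2 / 9 + 1) ∧
      (n % 6 = 1 → (Fodd k n : ℝ) = 2 * (n : ℝ) ^ 2 / 9 + ((n : ℝ) + 13) / 18) ∧
      (n % 6 = 2 → (Fodd k n : ℝ) = 2 * (n : ℝ) ^ 2 / 9 - ((n : ℝ) - 22) / 18) ∧
      (n % 6 = 3 → (Fodd k n : ℝ) = 2 * (n : ℝ) ^ 2 / 9 + 1) ∧
      (n % 6 = 4 → (Fodd k n : ℝ) = 2 * (n : ℝ) ^ 2 / 9 + ((n : ℝ) + 22) / 18) ∧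
      (n % 6 = 5 → (Fodd k n : ℝ) = 2 * (n : ℝ) ^ 2 / 9 - ((n : ℝ) - 13) / 18) := by
  intro k hk
  obtain ⟨n0, h0⟩ := Fodd_eq k hk
  have main : ∀ t n s a a1 b d e F : ℕ, 5 ≤ t → n0 ≤ n → 2 ≤ s → s ≤ n → n ≤ 3 * s + 2 →
      n = s + d → d = e + 1 → s^2/4 = a → (s+1)^2/4 = a1 → n^2/4 = b → d * e + 2 * a1 ≤ 2 * b →
      2 * (b + 1) ≤ 2 * a + (d + 1) * d → F + a = b + 1 → Fodd k n = F := by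
    intro t n s a a1 b d e F ht hn h1 h2 h3 h4 h5 ha ha1 hb hs hs' hF
    have hd : n - s = d := by omega
    have he : d - 1 = e := by omega
    have := h0 n hn s h1 h2 h3 (by rw [hd, he, ha1, hb]; exact hs) (by rw [hd, ha, hb]; exact hs')
    omega
  refine ⟨n0 + 100, fun n hn => ?_⟩
  obtain ⟨t, ht⟩ : ∃ t, t = n / 6 := ⟨_, rfl⟩
  have ht5 : 5 ≤ t := by omega
  have div4 : ∀ x y r : ℕ, x = 4 * y + r → r < 4 → x / 4 = y := by intros; omega
  refine ⟨fun h => ?_, fun h => ?_, fun h => ?_, fun h => ?_, fun h => ?_, fun h => ?_⟩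
  · have hnt : n = 6 * t := by omega
    rw [main t n (2*t) (t^2) (t^2+t) (9*t^2) (4*t) (4*t-1) (8*t^2+1) ht5 (by omega) (by omega)
      (by omega) (by omega) (by omega) (by omega) (div4 _ _ 0 (by ring) (by norm_num))
      (div4 _ _ 1 (by ring) (by norm_num)) (div4 _ _ 0 (by rw [hnt]; ring) (by norm_num))
      (by obtain ⟨u, rfl⟩ : ∃ u, t = u + 1 := ⟨t - 1, by omega⟩
          have : 4 * (u + 1) - 1 = 4 * u + 3 := by omega
          rw [this]; nlinarith) (by nlinarith) (by ring), hnt]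
    push_cast; ring
  · have hnt : n = 6 * t + 1 := by omega
    rw [main t n (2*t) (t^2) (t^2+t) (9*t^2+3*t) (4*t+1) (4*t) (8*t^2+3*t+1) ht5 (by omega) (by omega)
      (by omega) (by omega) (by omega) (by omega) (div4 _ _ 0 (by ring) (by norm_num))
      (div4 _ _ 1 (by ring) (by norm_num)) (div4 _ _ 1 (by rw [hnt]; ring) (by norm_num))
      (by nlinarith) (by nlinarith) (by ring), hnt]
    push_cast; ring
  · have hnt : n = 6 * t + 2 := by omega
    rw [main t n (2*t+1) (t^2+t) (t^2+2*t+1) (9*t^2+6*t+1) (4*t+1) (4*t) (8*t^2+5*t+2) ht5 (by omega)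
      (by omega) (by omega) (by omega) (by omega) (by omega) (div4 _ _ 1 (by ring) (by norm_num))
      (div4 _ _ 0 (by ring) (by norm_num)) (div4 _ _ 0 (by rw [hnt]; ring) (by norm_num))
      (by nlinarith) (by nlinarith) (by ring), hnt]
    push_cast; ring
  · have hnt : n = 6 * t + 3 := by omega
    rw [main t n (2*t+1) (t^2+t) (t^2+2*t+1) (9*t^2+9*t+2) (4*t+2) (4*t+1) (8*t^2+8*t+3) ht5 (by omega)
      (by omega) (by omega) (by omega) (by omega) (by omega) (div4 _ _ 1 (by ring) (by norm_num))
      (div4 _ _ 0 (by ring) (by norm_num)) (div4 _ _ 1 (by rw [hnt]; ring) (by norm_num))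
      (by nlinarith) (by nlinarith) (by ring), hnt]
    push_cast; ring
  · have hnt : n = 6 * t + 4 := by omega
    rw [main t n (2*t+1) (t^2+t) (t^2+2*t+1) (9*t^2+12*t+4) (4*t+3) (4*t+2) (8*t^2+11*t+5) ht5 (by omega)
      (by omega) (by omega) (by omega) (by omega) (by omega) (div4 _ _ 1 (by ring) (by norm_num))
      (div4 _ _ 0 (by ring) (by norm_num)) (div4 _ _ 0 (by rw [hnt]; ring) (by norm_num))
      (by nlinarith) (by nlinarith) (by ring), hnt]
    push_cast; ring
  · have hnt : n = 6 * t + 5 := by omega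
    rw [main t n (2*t+2) (t^2+2*t+1) (t^2+3*t+2) (9*t^2+15*t+6) (4*t+3) (4*t+2) (8*t^2+13*t+6) ht5 (by omega)
      (by omega) (by omega) (by omega) (by omega) (by omega) (div4 _ _ 0 (by ring) (by norm_num))
      (div4 _ _ 1 (by ring) (by norm_num)) (div4 _ _ 1 (by rw [hnt]; ring) (by norm_num))
      (by nlinarith) (by nlinarith) (by ring), hnt]
    push_cast; ring
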